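/- arXiv:math/0702705 — 7 statements merged into one kernel-verified Lean document; each statement's English description precedes it below -/
import Mathlib

section
/- Let α ∈ [-1,1] and T > 0. Let (u₁,v₁) and (u₂,v₂) be two classical solutions on [0,T] of the generalized Carleman system ∂_t u + ∂_x u = (u+v)^α (v−u), ∂_t v − ∂_x v = (u+v)^α (u−v) on (0,T)×(0,1), both satisfying the same boundary conditions u_i(t,0) = φ⁻(t) and v_i(t,1) = φ⁺(t) for t ∈ (0,T). Then the map t ↦ ∫₀¹ (|u₁−u₂| + |v₁−v₂|)(t,x) dx is nonincreasing on [0,T]; in particular, if moreover u₁(0,·) = u₂(0,·) and v₁(0,·) = v₂(0,·) on [0,1], then (u₁,v₁) = (u₂,v₂) on [0,T]×[0,1]. -/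
open MeasureTheory Set intervalIntegral

/-- A classical solution of the (unscaled) generalized Carleman system on `[0,T] × [0,1]`:
a pair `(u,v)` of `C¹` functions, nonnegative with positive total density, satisfying
`∂ₜ u + ∂ₓ u = (u+v)^α (v-u)` and `∂ₜ v - ∂ₓ v = (u+v)^α (u-v)` pointwise in the interior,
together with the inflow boundary conditions `u(t,0) = φ⁻(t)`, `v(t,1) = φ⁺(t)`. -/
def IsCarlemanSol (α T : ℝ) (φm φp : ℝ → ℝ) (u v : ℝ → ℝ → ℝ) : Prop :=
  ContDiffOn ℝ 1 (fun p : ℝ × ℝ => u p.1 p.2) (Set.Icc 0 T ×ˢ Set.Icc (0:ℝ) 1) ∧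
  ContDiffOn ℝ 1 (fun p : ℝ × ℝ => v p.1 p.2) (Set.Icc 0 T ×ˢ Set.Icc (0:ℝ) 1) ∧
  (∀ t ∈ Set.Icc (0:ℝ) T, ∀ x ∈ Set.Icc (0:ℝ) 1,
      0 ≤ u t x ∧ 0 ≤ v t x ∧ 0 < u t x + v t x) ∧
  (∀ t ∈ Set.Ioo (0:ℝ) T, ∀ x ∈ Set.Ioo (0:ℝ) 1,
      deriv (fun s => u s x) t + deriv (fun y => u t y) x
        = (u t x + v t x) ^ α * (v t x - u t x) ∧
      deriv (fun s => v s x) t - deriv (fun y => v t y) x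
        = (u t x + v t x) ^ α * (u t x - v t x)) ∧
  (∀ t ∈ Set.Ioo (0:ℝ) T, u t 0 = φm t ∧ v t 1 = φp t)

/-- The smoothed absolute value `r ↦ √(r² + ε²)`. -/
noncomputable def smoothAbs (ε r : ℝ) : ℝ := √(r ^ 2 + ε ^ 2)

/-- The derivative of `smoothAbs ε`, a smoothed sign function. -/
noncomputable def smoothSign (ε r : ℝ) : ℝ := r / smoothAbs ε r

lemma smoothAbs_pos {ε : ℝ} (hε : 0 < ε) (r : ℝ) : 0 < smoothAbs ε r :=
  Real.sqrt_pos.2 (by positivity)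

lemma sq_smoothAbs (ε r : ℝ) : smoothAbs ε r ^ 2 = r ^ 2 + ε ^ 2 :=
  Real.sq_sqrt (by positivity)

lemma abs_le_smoothAbs (ε r : ℝ) : |r| ≤ smoothAbs ε r :=
  Real.abs_le_sqrt (by nlinarith [sq_nonneg ε])

lemma smoothAbs_le {ε : ℝ} (hε : 0 ≤ ε) (r : ℝ) : smoothAbs ε r ≤ |r| + ε := by
  refine Real.sqrt_le_iff.2 ⟨by positivity, ?_⟩
  nlinarith [sq_abs r, mul_nonneg (abs_nonneg r) hε]

lemma smoothAbs_zero_le (ε r : ℝ) : smoothAbs ε 0 ≤ smoothAbs ε r :=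
  Real.sqrt_le_sqrt (by nlinarith [sq_nonneg r])

lemma continuous_smoothAbs (ε : ℝ) : Continuous (smoothAbs ε) := by
  unfold smoothAbs; fun_prop

lemma continuous_smoothSign {ε : ℝ} (hε : 0 < ε) : Continuous (smoothSign ε) :=
  continuous_id.div (continuous_smoothAbs ε) fun r => (smoothAbs_pos hε r).ne'

lemma hasDerivAt_smoothAbs {ε : ℝ} (hε : 0 < ε) (r : ℝ) :
    HasDerivAt (smoothAbs ε) (smoothSign ε r) r := by
  have h : HasDerivAt (fun r : ℝ => r ^ 2 + ε ^ 2) (2 * r) r := by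
    simpa using (hasDerivAt_pow 2 r).add_const (ε ^ 2)
  have h' : HasDerivAt (smoothAbs ε) (2 * r / (2 * smoothAbs ε r)) r := h.sqrt (by positivity)
  rwa [mul_div_mul_left _ _ two_ne_zero] at h'

lemma abs_smoothSign_le_one {ε : ℝ} (hε : 0 < ε) (r : ℝ) : |smoothSign ε r| ≤ 1 := by
  rw [smoothSign, abs_div, abs_of_pos (smoothAbs_pos hε r), div_le_one (smoothAbs_pos hε r)]
  exact abs_le_smoothAbs ε r

lemma abs_sub_le_smoothSign_mul {ε : ℝ} (hε : 0 < ε) (r : ℝ) :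
    |r| - ε ≤ smoothSign ε r * r := by
  have hS := smoothAbs_pos hε r
  have h : smoothSign ε r * r = r ^ 2 / smoothAbs ε r := by
    rw [smoothSign]; ring
  rw [h, le_div_iff₀ hS]
  nlinarith [sq_smoothAbs ε r, abs_le_smoothAbs ε r, smoothAbs_le hε.le r, sq_abs r,
    abs_nonneg r]

lemma smoothSign_sub_mul_le {ε a b w z : ℝ} (hε : 0 < ε) (ha : 0 ≤ a) (hb : 0 ≤ b) :
    (smoothSign ε w - smoothSign ε z) * (b * z - a * w) ≤ (a + b) * ε := by
  have hcross (x y : ℝ) : smoothSign ε x * y ≤ |y| :=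
    (le_abs_self _).trans <| by
      rw [abs_mul]
      exact mul_le_of_le_one_left (abs_nonneg y) (abs_smoothSign_le_one hε x)
  have h₁ := mul_le_mul_of_nonneg_left (abs_sub_le_smoothSign_mul hε w) ha
  have h₂ := mul_le_mul_of_nonneg_left (abs_sub_le_smoothSign_mul hε z) hb
  have h₃ := mul_le_mul_of_nonneg_left (hcross w z) hb
  have h₄ := mul_le_mul_of_nonneg_left (hcross z w) ha
  linarith

/-- The Carleman collision term is nonincreasing in `u` and nondecreasing in `v`, with
quantitative control of the difference quotients. -/
lemma exists_collision_sub_eq {α u₁ v₁ u₂ v₂ : ℝ} (hα : α ∈ Icc (-1 : ℝ) 1)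
    (hu₁ : 0 ≤ u₁) (hv₁ : 0 ≤ v₁) (hu₂ : 0 ≤ u₂) (hv₂ : 0 ≤ v₂)
    (h₁ : 0 < u₁ + v₁) (h₂ : 0 < u₂ + v₂) :
    ∃ ρ ∈ uIcc (u₁ + v₁) (u₂ + v₂), ∃ a b : ℝ, 0 ≤ a ∧ 0 ≤ b ∧ a + b = 2 * ρ ^ α ∧
      (u₁ + v₁) ^ α * (v₁ - u₁) - (u₂ + v₂) ^ α * (v₂ - u₂)
        = b * (v₁ - v₂) - a * (u₁ - u₂) := by
  set U : ℝ → ℝ := fun s => u₂ + s * (u₁ - u₂) with hU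
  set V : ℝ → ℝ := fun s => v₂ + s * (v₁ - v₂) with hV
  have hdU (s : ℝ) : HasDerivAt U (u₁ - u₂) s := by
    simpa only [one_mul] using ((hasDerivAt_id' s).mul_const (u₁ - u₂)).const_add u₂
  have hdV (s : ℝ) : HasDerivAt V (v₁ - v₂) s := by
    simpa only [one_mul] using ((hasDerivAt_id' s).mul_const (v₁ - v₂)).const_add v₂
  have hconv {x y s : ℝ} (hs : s ∈ Icc (0 : ℝ) 1) : y + s * (x - y) ∈ uIcc x y := by
    rcases le_total x y with h | h
    · rw [uIcc_of_le h]
      constructor <;> nlinarith [hs.1, hs.2]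
    · rw [uIcc_of_ge h]
      constructor <;> nlinarith [hs.1, hs.2]
  have hmem {s : ℝ} (hs : s ∈ Icc (0 : ℝ) 1) : U s + V s ∈ uIcc (u₁ + v₁) (u₂ + v₂) := by
    convert hconv (x := u₁ + v₁) (y := u₂ + v₂) hs using 1
    simp only [hU, hV]; ring
  have hpos {s : ℝ} (hs : s ∈ Icc (0 : ℝ) 1) : 0 < U s + V s :=
    (lt_min h₁ h₂).trans_le (hmem hs).1
  have hd {s : ℝ} (hs : s ∈ Icc (0 : ℝ) 1) :=
    (((hdU s).add (hdV s)).rpow_const (p := α) (Or.inl (hpos hs).ne')).mul ((hdV s).sub (hdU s))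
  obtain ⟨c, hc, hslope⟩ := exists_hasDerivAt_eq_slope _ _ zero_lt_one
    (fun s hs => (hd hs).continuousAt.continuousWithinAt) fun s hs => hd (Ioo_subset_Icc_self hs)
  have hc' := Ioo_subset_Icc_self hc
  have hρ := hpos hc'
  have hUc : 0 ≤ U c := (le_min hu₁ hu₂).trans (hconv hc').1
  have hVc : 0 ≤ V c := (le_min hv₁ hv₂).trans (hconv hc').1
  have hrpow : (U c + V c) ^ α = (U c + V c) ^ (α - 1) * (U c + V c) := by
    rw [← Real.rpow_add_one hρ.ne', sub_add_cancel]
  have hα₁ : 0 ≤ 1 + α := by linarith [hα.1]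
  have hα₂ : 0 ≤ 1 - α := by linarith [hα.2]
  refine ⟨_, hmem hc', (U c + V c) ^ (α - 1) * ((1 - α) * V c + (1 + α) * U c),
    (U c + V c) ^ (α - 1) * ((1 + α) * V c + (1 - α) * U c), by positivity, by positivity, ?_, ?_⟩
  · rw [hrpow]; ring
  · simp only [Pi.add_apply, Pi.mul_apply, Pi.sub_apply, hrpow] at hslope
    simp only [hU, hV, one_mul, zero_mul, add_zero, sub_zero, div_one, add_sub_cancel] at hslope ⊢
    rw [← hslope]; ring

/-- Integrated `L¹` estimate for a pair of counter-propagating transport equations on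
`[s,t] × [0,1]` with homogeneous inflow data, whose opposite source terms `± F` are
of monotone type. -/
lemma integral_abs_add_abs_le_of_transport {s t C : ℝ} (hst : s ≤ t) {w z F : ℝ × ℝ → ℝ}
    (hw : ContinuousOn w (Icc s t ×ˢ Icc 0 1)) (hz : ContinuousOn z (Icc s t ×ˢ Icc 0 1))
    (hF : ContinuousOn F (Icc s t ×ˢ Icc 0 1))
    (hdw : ∀ p ∈ Ioo s t ×ˢ Ioo (0 : ℝ) 1, DifferentiableAt ℝ w p)
    (hdz : ∀ p ∈ Ioo s t ×ˢ Ioo (0 : ℝ) 1, DifferentiableAt ℝ z p)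
    (hew : ∀ p ∈ Ioo s t ×ˢ Ioo (0 : ℝ) 1, fderiv ℝ w p (1, 0) + fderiv ℝ w p (0, 1) = F p)
    (hez : ∀ p ∈ Ioo s t ×ˢ Ioo (0 : ℝ) 1, fderiv ℝ z p (1, 0) - fderiv ℝ z p (0, 1) = -F p)
    (hmono : ∀ p ∈ Ioo s t ×ˢ Ioo (0 : ℝ) 1,
      ∃ a b : ℝ, 0 ≤ a ∧ 0 ≤ b ∧ a + b ≤ C ∧ F p = b * z p - a * w p)
    (hbw : ∀ τ ∈ Ioo s t, w (τ, 0) = 0) (hbz : ∀ τ ∈ Ioo s t, z (τ, 1) = 0) :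
    ∫ x in (0 : ℝ)..1, (|w (t, x)| + |z (t, x)|) ≤
      ∫ x in (0 : ℝ)..1, (|w (s, x)| + |z (s, x)|) := by
  have hslice {f : ℝ × ℝ → ℝ} (hf : ContinuousOn f (Icc s t ×ˢ Icc 0 1)) {τ : ℝ}
      (hτ : τ ∈ Icc s t) : ContinuousOn (fun x => f (τ, x)) (uIcc 0 1) := by
    rw [uIcc_of_le zero_le_one]
    exact hf.comp (by fun_prop) fun x hx => ⟨hτ, hx⟩
  have hside {f : ℝ × ℝ → ℝ} (hf : ContinuousOn f (Icc s t ×ˢ Icc 0 1)) {x : ℝ}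
      (hx : x ∈ Icc (0 : ℝ) 1) : ContinuousOn (fun τ => f (τ, x)) (uIcc s t) := by
    rw [uIcc_of_le hst]
    exact hf.comp (by fun_prop) fun τ hτ => ⟨hτ, hx⟩
  have hS {f : ℝ × ℝ → ℝ} (hf : ContinuousOn f (Icc s t ×ˢ Icc 0 1)) (ε : ℝ) :
      ContinuousOn (fun p => smoothAbs ε (f p)) (Icc s t ×ˢ Icc 0 1) :=
    (continuous_smoothAbs ε).comp_continuousOn hf
  have ht' : t ∈ Icc s t := right_mem_Icc.2 hst
  have hs' : s ∈ Icc s t := left_mem_Icc.2 hst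
  have hIcc : Icc (s, (0 : ℝ)) (t, 1) = Icc s t ×ˢ Icc 0 1 := (Icc_prod_Icc _ _ _ _).symm
  have hae : (Ioo s t ×ˢ Ioo (0 : ℝ) 1 : Set (ℝ × ℝ)) =ᵐ[volume] Icc (s, (0 : ℝ)) (t, 1) := by
    rw [hIcc]
    exact Measure.set_prod_ae_eq Ioo_ae_eq_Icc Ioo_ae_eq_Icc
  have key {ε : ℝ} (hε : 0 < ε) :
      ∫ x in (0 : ℝ)..1, (|w (t, x)| + |z (t, x)|) ≤
        (∫ x in (0 : ℝ)..1, (|w (s, x)| + |z (s, x)|)) + (2 + C * (t - s)) * ε := by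
    set D : ℝ × ℝ → ℝ := fun p => (smoothSign ε (w p) - smoothSign ε (z p)) * F p with hD
    have hDc : ContinuousOn D (Icc s t ×ˢ Icc 0 1) :=
      (((continuous_smoothSign hε).comp_continuousOn hw).sub
        ((continuous_smoothSign hε).comp_continuousOn hz)).mul hF
    have hDi : IntegrableOn D (Icc (s, (0 : ℝ)) (t, 1)) := by
      rw [hIcc]
      exact hDc.integrableOn_compact (isCompact_Icc.prod isCompact_Icc)
    have hdiv {p : ℝ × ℝ} (hp : p ∈ Ioo s t ×ˢ Ioo (0 : ℝ) 1) :
        (smoothSign ε (w p) • fderiv ℝ w p + smoothSign ε (z p) • fderiv ℝ z p) (1, 0) +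
          (smoothSign ε (w p) • fderiv ℝ w p - smoothSign ε (z p) • fderiv ℝ z p) (0, 1) = D p := by
      simp only [hD, add_apply, sub_apply,
        smul_apply, smul_eq_mul]
      linear_combination smoothSign ε (w p) * hew p hp + smoothSign ε (z p) * hez p hp
    have hgreen := integral_divergence_prod_Icc_of_hasFDerivAt_of_le
      (fun p => smoothAbs ε (w p) + smoothAbs ε (z p))
      (fun p => smoothAbs ε (w p) - smoothAbs ε (z p))
      (fun p => smoothSign ε (w p) • fderiv ℝ w p + smoothSign ε (z p) • fderiv ℝ z p)
      (fun p => smoothSign ε (w p) • fderiv ℝ w p - smoothSign ε (z p) • fderiv ℝ z p)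
      (s, 0) (t, 1) ⟨hst, zero_le_one⟩
      (hIcc ▸ (hS hw ε).add (hS hz ε)) (hIcc ▸ (hS hw ε).sub (hS hz ε))
      (fun p hp => ((hasDerivAt_smoothAbs hε _).comp_hasFDerivAt p (hdw p hp).hasFDerivAt).add
        ((hasDerivAt_smoothAbs hε _).comp_hasFDerivAt p (hdz p hp).hasFDerivAt))
      (fun p hp => ((hasDerivAt_smoothAbs hε _).comp_hasFDerivAt p (hdw p hp).hasFDerivAt).sub
        ((hasDerivAt_smoothAbs hε _).comp_hasFDerivAt p (hdz p hp).hasFDerivAt))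
      (((hDi.mono_set_ae hae.le).congr_fun (fun p hp => (hdiv hp).symm)
        (measurableSet_Ioo.prod measurableSet_Ioo)).congr_set_ae hae.symm)
    rw [← setIntegral_congr_set hae,
      setIntegral_congr_fun (measurableSet_Ioo.prod measurableSet_Ioo) (fun p hp => hdiv hp)]
      at hgreen
    simp only at hgreen
    have hDle : ∫ p in Ioo s t ×ˢ Ioo (0 : ℝ) 1, D p ≤ C * (t - s) * ε := by
      calc ∫ p in Ioo s t ×ˢ Ioo (0 : ℝ) 1, D p
          ≤ ∫ _ in Ioo s t ×ˢ Ioo (0 : ℝ) 1, C * ε := by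
            refine setIntegral_mono_on (hDi.mono_set_ae hae.le) ?_
              (measurableSet_Ioo.prod measurableSet_Ioo) fun p hp => ?_
            · exact (integrableOn_const (s := Icc (s, (0 : ℝ)) (t, 1))
                isCompact_Icc.measure_lt_top.ne).mono_set_ae hae.le
            · obtain ⟨a, b, ha, hb, hab, hFp⟩ := hmono p hp
              simp only [hD, hFp]
              exact (smoothSign_sub_mul_le hε ha hb).trans (by gcongr)
        _ = C * (t - s) * ε := by
            rw [setIntegral_const, Measure.volume_eq_prod, measureReal_prod_prod]
            simp [hst]; ring
    have hboundary : ∫ τ in s..t, (smoothAbs ε (w (τ, 0)) - smoothAbs ε (z (τ, 0))) ≤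
        ∫ τ in s..t, (smoothAbs ε (w (τ, 1)) - smoothAbs ε (z (τ, 1))) := by
      refine integral_mono_on_of_le_Ioo hst
        (hside ((hS hw ε).sub (hS hz ε)) (left_mem_Icc.2 zero_le_one)).intervalIntegrable
        (hside ((hS hw ε).sub (hS hz ε)) (right_mem_Icc.2 zero_le_one)).intervalIntegrable
        fun τ hτ => ?_
      rw [hbw τ hτ, hbz τ hτ]
      linarith [smoothAbs_zero_le ε (w (τ, 1)), smoothAbs_zero_le ε (z (τ, 0))]
    have hlow : ∫ x in (0 : ℝ)..1, (|w (t, x)| + |z (t, x)|) ≤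
        ∫ x in (0 : ℝ)..1, (smoothAbs ε (w (t, x)) + smoothAbs ε (z (t, x))) :=
      integral_mono_on zero_le_one
        (hslice (hw.abs.add hz.abs) ht').intervalIntegrable
        (hslice ((hS hw ε).add (hS hz ε)) ht').intervalIntegrable
        fun x _ => add_le_add (abs_le_smoothAbs ε _) (abs_le_smoothAbs ε _)
    have hupp : ∫ x in (0 : ℝ)..1, (smoothAbs ε (w (s, x)) + smoothAbs ε (z (s, x))) ≤
        (∫ x in (0 : ℝ)..1, (|w (s, x)| + |z (s, x)|)) + 2 * ε := by
      have hi : IntervalIntegrable (fun x => |w (s, x)| + |z (s, x)|) volume 0 1 :=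
        (hslice (hw.abs.add hz.abs) hs').intervalIntegrable
      calc ∫ x in (0 : ℝ)..1, (smoothAbs ε (w (s, x)) + smoothAbs ε (z (s, x)))
          ≤ ∫ x in (0 : ℝ)..1, ((|w (s, x)| + |z (s, x)|) + 2 * ε) :=
            integral_mono_on zero_le_one
              (hslice ((hS hw ε).add (hS hz ε)) hs').intervalIntegrable
              (hi.add intervalIntegrable_const)
              fun x _ => by linarith [smoothAbs_le hε.le (w (s, x)), smoothAbs_le hε.le (z (s, x))]
        _ = (∫ x in (0 : ℝ)..1, (|w (s, x)| + |z (s, x)|)) + 2 * ε := by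
            rw [intervalIntegral.integral_add hi intervalIntegrable_const]
            simp
    linarith
  have hlim : Filter.Tendsto (fun ε : ℝ =>
      (∫ x in (0 : ℝ)..1, (|w (s, x)| + |z (s, x)|)) + (2 + C * (t - s)) * ε)
      (nhdsWithin 0 (Ioi 0)) (nhds (∫ x in (0 : ℝ)..1, (|w (s, x)| + |z (s, x)|))) := by
    refine Filter.Tendsto.mono_left (Continuous.tendsto' (by fun_prop) _ _ (by simp))
      nhdsWithin_le_nhds
  exact ge_of_tendsto hlim (Filter.eventually_of_mem self_mem_nhdsWithin fun ε hε => key hε)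

/-- Partial derivatives of a differentiable function of two real variables. -/
lemma DifferentiableAt.deriv_fst_snd {f : ℝ → ℝ → ℝ} {p : ℝ × ℝ}
    (h : DifferentiableAt ℝ (fun q : ℝ × ℝ => f q.1 q.2) p) :
    deriv (fun s => f s p.2) p.1 = fderiv ℝ (fun q : ℝ × ℝ => f q.1 q.2) p (1, 0) ∧
      deriv (fun y => f p.1 y) p.2 = fderiv ℝ (fun q : ℝ × ℝ => f q.1 q.2) p (0, 1) :=
  ⟨(h.hasFDerivAt.comp_hasDerivAt (f := fun s => (s, p.2)) p.1
      ((hasDerivAt_id p.1).prodMk (hasDerivAt_const p.1 p.2))).deriv,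
    (h.hasFDerivAt.comp_hasDerivAt (f := fun y => (p.1, y)) p.2
      ((hasDerivAt_const p.2 p.1).prodMk (hasDerivAt_id p.2))).deriv⟩

/-- L¹-contraction / uniqueness for the initial-boundary value problem of the generalized
Carleman system: for two classical solutions with the same boundary data, the map
`t ↦ ∫₀¹ (|u₁-u₂| + |v₁-v₂|) dx` is nonincreasing on `[0,T]`; in particular solutions
with the same initial data coincide. -/
theorem carleman_L1_contraction_and_uniqueness
    (α T : ℝ) (hα : α ∈ Set.Icc (-1:ℝ) 1) (hT : 0 < T)
    (φm φp : ℝ → ℝ)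
    (hφm : ContDiffOn ℝ 1 φm (Set.Icc 0 T)) (hφp : ContDiffOn ℝ 1 φp (Set.Icc 0 T))
    (hφmpos : ∀ t ∈ Set.Icc (0:ℝ) T, 0 < φm t)
    (hφppos : ∀ t ∈ Set.Icc (0:ℝ) T, 0 < φp t)
    (u₁ v₁ u₂ v₂ : ℝ → ℝ → ℝ)
    (h₁ : IsCarlemanSol α T φm φp u₁ v₁)
    (h₂ : IsCarlemanSol α T φm φp u₂ v₂) :
    AntitoneOn
      (fun t => ∫ x in (0:ℝ)..1, (|u₁ t x - u₂ t x| + |v₁ t x - v₂ t x|))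
      (Set.Icc 0 T) ∧
    ((∀ x ∈ Set.Icc (0:ℝ) 1, u₁ 0 x = u₂ 0 x ∧ v₁ 0 x = v₂ 0 x) →
      ∀ t ∈ Set.Icc (0:ℝ) T, ∀ x ∈ Set.Icc (0:ℝ) 1,
        u₁ t x = u₂ t x ∧ v₁ t x = v₂ t x) := by
  obtain ⟨hu₁, hv₁, hpos₁, heq₁, hbd₁⟩ := h₁
  obtain ⟨hu₂, hv₂, hpos₂, heq₂, hbd₂⟩ := h₂
  have hdiff {f : ℝ × ℝ → ℝ} (hf : ContDiffOn ℝ 1 f (Icc 0 T ×ˢ Icc (0 : ℝ) 1)) {p : ℝ × ℝ}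
      (hp : p ∈ Ioo 0 T ×ˢ Ioo (0 : ℝ) 1) : DifferentiableAt ℝ f p :=
    (hf.differentiableOn one_ne_zero).differentiableAt
      (prod_mem_nhds (Icc_mem_nhds hp.1.1 hp.1.2) (Icc_mem_nhds hp.2.1 hp.2.2))
  have hrc {u v : ℝ → ℝ → ℝ}
      (hu : ContDiffOn ℝ 1 (fun p : ℝ × ℝ => u p.1 p.2) (Icc 0 T ×ˢ Icc (0 : ℝ) 1))
      (hv : ContDiffOn ℝ 1 (fun p : ℝ × ℝ => v p.1 p.2) (Icc 0 T ×ˢ Icc (0 : ℝ) 1))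
      (hpos : ∀ t ∈ Icc (0 : ℝ) T, ∀ x ∈ Icc (0 : ℝ) 1, 0 ≤ u t x ∧ 0 ≤ v t x ∧ 0 < u t x + v t x) :
      ContinuousOn (fun p : ℝ × ℝ => (u p.1 p.2 + v p.1 p.2) ^ α) (Icc 0 T ×ˢ Icc (0 : ℝ) 1) :=
    (hu.continuousOn.add hv.continuousOn).rpow_const
      fun p hp => Or.inl (hpos p.1 hp.1 p.2 hp.2).2.2.ne'
  have hcompact : IsCompact (Icc 0 T ×ˢ Icc (0 : ℝ) 1) := isCompact_Icc.prod isCompact_Icc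
  obtain ⟨K₁, hK₁⟩ := hcompact.exists_bound_of_continuousOn (hrc hu₁ hv₁ hpos₁)
  obtain ⟨K₂, hK₂⟩ := hcompact.exists_bound_of_continuousOn (hrc hu₂ hv₂ hpos₂)
  have hrpow_le {x y ρ : ℝ} (hx : 0 < x) (hy : 0 < y) (hρ : ρ ∈ uIcc x y) :
      ρ ^ α ≤ max (x ^ α) (y ^ α) := by
    wlog hxy : x ≤ y generalizing x y
    · rw [max_comm]
      exact this hy hx (uIcc_comm x y ▸ hρ) (le_of_not_ge hxy)
    rw [uIcc_of_le hxy] at hρ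
    rcases le_total 0 α with h | h
    · exact le_max_of_le_right (Real.rpow_le_rpow (hx.le.trans hρ.1) hρ.2 h)
    · exact le_max_of_le_left (Real.rpow_le_rpow_of_nonpos hx hρ.1 h)
  have hcw : ContinuousOn (fun p : ℝ × ℝ => u₁ p.1 p.2 - u₂ p.1 p.2)
      (Icc 0 T ×ˢ Icc (0 : ℝ) 1) := hu₁.continuousOn.sub hu₂.continuousOn
  have hcz : ContinuousOn (fun p : ℝ × ℝ => v₁ p.1 p.2 - v₂ p.1 p.2)
      (Icc 0 T ×ˢ Icc (0 : ℝ) 1) := hv₁.continuousOn.sub hv₂.continuousOn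
  have hanti : AntitoneOn
      (fun t => ∫ x in (0:ℝ)..1, (|u₁ t x - u₂ t x| + |v₁ t x - v₂ t x|)) (Icc 0 T) := by
    intro s hs t ht hst
    have hsub : Icc s t ×ˢ Icc (0 : ℝ) 1 ⊆ Icc 0 T ×ˢ Icc (0 : ℝ) 1 :=
      prod_mono (Icc_subset_Icc hs.1 ht.2) subset_rfl
    have hsubo : Ioo s t ⊆ Ioo 0 T := Ioo_subset_Ioo hs.1 ht.2
    have hmem {p : ℝ × ℝ} (hp : p ∈ Ioo s t ×ˢ Ioo (0 : ℝ) 1) : p ∈ Ioo 0 T ×ˢ Ioo (0 : ℝ) 1 :=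
      ⟨hsubo hp.1, hp.2⟩
    refine integral_abs_add_abs_le_of_transport (C := 2 * max K₁ K₂) hst
      (w := fun p => u₁ p.1 p.2 - u₂ p.1 p.2) (z := fun p => v₁ p.1 p.2 - v₂ p.1 p.2)
      (F := fun p => (u₁ p.1 p.2 + v₁ p.1 p.2) ^ α * (v₁ p.1 p.2 - u₁ p.1 p.2) -
        (u₂ p.1 p.2 + v₂ p.1 p.2) ^ α * (v₂ p.1 p.2 - u₂ p.1 p.2))
      (hcw.mono hsub) (hcz.mono hsub) ?_
      (fun p hp => (hdiff hu₁ (hmem hp)).sub (hdiff hu₂ (hmem hp)))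
      (fun p hp => (hdiff hv₁ (hmem hp)).sub (hdiff hv₂ (hmem hp))) ?_ ?_ ?_ ?_ ?_
    · exact (((hrc hu₁ hv₁ hpos₁).mul (hv₁.continuousOn.sub hu₁.continuousOn)).sub
        ((hrc hu₂ hv₂ hpos₂).mul (hv₂.continuousOn.sub hu₂.continuousOn))).mono hsub
    · intro p hp
      have d₁ := hdiff hu₁ (hmem hp)
      have d₂ := hdiff hu₂ (hmem hp)
      have e₁ := (heq₁ p.1 (hmem hp).1 p.2 hp.2).1
      have e₂ := (heq₂ p.1 (hmem hp).1 p.2 hp.2).1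
      rw [d₁.deriv_fst_snd.1, d₁.deriv_fst_snd.2] at e₁
      rw [d₂.deriv_fst_snd.1, d₂.deriv_fst_snd.2] at e₂
      rw [fderiv_fun_sub d₁ d₂, sub_apply, sub_apply]
      linear_combination e₁ - e₂
    · intro p hp
      have d₁ := hdiff hv₁ (hmem hp)
      have d₂ := hdiff hv₂ (hmem hp)
      have e₁ := (heq₁ p.1 (hmem hp).1 p.2 hp.2).2
      have e₂ := (heq₂ p.1 (hmem hp).1 p.2 hp.2).2
      rw [d₁.deriv_fst_snd.1, d₁.deriv_fst_snd.2] at e₁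
      rw [d₂.deriv_fst_snd.1, d₂.deriv_fst_snd.2] at e₂
      rw [fderiv_fun_sub d₁ d₂, sub_apply, sub_apply]
      linear_combination e₁ - e₂
    · intro p hp
      have hp' : p ∈ Icc 0 T ×ˢ Icc (0 : ℝ) 1 :=
        prod_mono Ioo_subset_Icc_self Ioo_subset_Icc_self (hmem hp)
      obtain ⟨hu₁p, hv₁p, hρ₁⟩ := hpos₁ p.1 hp'.1 p.2 hp'.2
      obtain ⟨hu₂p, hv₂p, hρ₂⟩ := hpos₂ p.1 hp'.1 p.2 hp'.2
      obtain ⟨ρ, hρ, a, b, ha, hb, hab, hF⟩ :=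
        exists_collision_sub_eq hα hu₁p hv₁p hu₂p hv₂p hρ₁ hρ₂
      refine ⟨a, b, ha, hb, ?_, hF⟩
      rw [hab]
      exact mul_le_mul_of_nonneg_left ((hrpow_le hρ₁ hρ₂ hρ).trans
        (max_le_max ((le_abs_self _).trans (hK₁ p hp')) ((le_abs_self _).trans (hK₂ p hp'))))
        zero_le_two
    · intro τ hτ
      simp only [(hbd₁ τ (hsubo hτ)).1, (hbd₂ τ (hsubo hτ)).1, sub_self]
    · intro τ hτ
      simp only [(hbd₁ τ (hsubo hτ)).2, (hbd₂ τ (hsubo hτ)).2, sub_self]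
  refine ⟨hanti, fun h0 t ht x hx => ?_⟩
  have hint0 : ∫ x in (0:ℝ)..1, (|u₁ 0 x - u₂ 0 x| + |v₁ 0 x - v₂ 0 x|) = 0 := by
    refine (integral_congr (g := fun _ => (0 : ℝ)) fun y hy => ?_).trans (by simp)
    rw [uIcc_of_le zero_le_one] at hy
    simp [h0 y hy]
  have hle := hanti (left_mem_Icc.2 hT.le) ht ht.1
  simp only [hint0] at hle
  have hzero : |u₁ t x - u₂ t x| + |v₁ t x - v₂ t x| ≤ 0 := by
    by_contra! hlt
    refine hle.not_gt (integral_pos zero_lt_one ?_ (fun y _ => by positivity) ⟨x, hx, hlt⟩)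
    exact (hcw.abs.add hcz.abs).comp (f := fun y : ℝ => (t, y)) (by fun_prop) fun y hy => ⟨ht, hy⟩
  have hu := abs_nonneg (u₁ t x - u₂ t x)
  have hv := abs_nonneg (v₁ t x - v₂ t x)
  exact ⟨sub_eq_zero.1 (abs_eq_zero.1 (by linarith)), sub_eq_zero.1 (abs_eq_zero.1 (by linarith))⟩
end

section
/- Fix α ∈ [-1,1], T > 0 and admissible data (u_in, v_in, φ⁻, φ⁺). Then there exists a constant J > 0, depending only on α, T, φ⁻, φ⁺, u_in, v_in (and not on ε), such that for every ε > 0 and every classical solution (u_ε, v_ε) on [0,T] of the scaled generalized Carleman system with these data, the current j_ε = (u_ε − v_ε)/ε satisfies ∫₀ᵀ ∫₀¹ j_ε(t,x)² dx dt ≤ J. -/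
open MeasureTheory Set intervalIntegral

/-- Admissible data for the generalized Carleman system on `[0,T] × [0,1]`:
`C¹` positive boundary data `φ⁻, φ⁺` and continuous nonnegative initial data `u_in, v_in`. -/
def AdmissibleData (T : ℝ) (φm φp uin vin : ℝ → ℝ) : Prop :=
  ContDiffOn ℝ 1 φm (Set.Icc 0 T) ∧ ContDiffOn ℝ 1 φp (Set.Icc 0 T) ∧
  (∀ t ∈ Set.Icc (0:ℝ) T, 0 < φm t ∧ 0 < φp t) ∧
  ContinuousOn uin (Set.Icc (0:ℝ) 1) ∧ ContinuousOn vin (Set.Icc (0:ℝ) 1) ∧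
  (∀ x ∈ Set.Icc (0:ℝ) 1, 0 ≤ uin x ∧ 0 ≤ vin x)

/-- A classical solution of the scaled generalized Carleman system on `[0,T] × [0,1]`
with parameter `α`, scaling `ε`, inflow boundary data `φ⁻, φ⁺` and initial data
`u_in, v_in`: a pair `(u,v)` of `C¹` functions, nonnegative with positive total density,
satisfying `ε² ∂ₜ u + ε ∂ₓ u = (u+v)^α (v-u)`, `ε² ∂ₜ v - ε ∂ₓ v = (u+v)^α (u-v)`
pointwise in the interior, together with the boundary and initial conditions. -/
def IsScaledCarlemanSol (α T ε : ℝ) (φm φp uin vin : ℝ → ℝ) (u v : ℝ → ℝ → ℝ) : Prop :=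
  ContDiffOn ℝ 1 (fun p : ℝ × ℝ => u p.1 p.2) (Set.Icc 0 T ×ˢ Set.Icc (0:ℝ) 1) ∧
  ContDiffOn ℝ 1 (fun p : ℝ × ℝ => v p.1 p.2) (Set.Icc 0 T ×ˢ Set.Icc (0:ℝ) 1) ∧
  (∀ t ∈ Set.Icc (0:ℝ) T, ∀ x ∈ Set.Icc (0:ℝ) 1,
      0 ≤ u t x ∧ 0 ≤ v t x ∧ 0 < u t x + v t x) ∧
  (∀ t ∈ Set.Ioo (0:ℝ) T, ∀ x ∈ Set.Ioo (0:ℝ) 1,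
      ε ^ 2 * deriv (fun s => u s x) t + ε * deriv (fun y => u t y) x
        = (u t x + v t x) ^ α * (v t x - u t x) ∧
      ε ^ 2 * deriv (fun s => v s x) t - ε * deriv (fun y => v t y) x
        = (u t x + v t x) ^ α * (u t x - v t x)) ∧
  (∀ t ∈ Set.Ioo (0:ℝ) T, u t 0 = φm t ∧ v t 1 = φp t) ∧
  (∀ x ∈ Set.Icc (0:ℝ) 1, u 0 x = uin x ∧ v 0 x = vin x)

/-- The divergence theorem on `[0,T] × [0,1]` as an inequality, for a density `P` that is nonnegative
at the final time and a flux `Q` pointing outwards, when the divergence is only known to agree in the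
interior with a function continuous up to the boundary. -/
theorem neg_le_integral_divergence {T C : ℝ} (hT : 0 < T) {P Q R : ℝ × ℝ → ℝ}
    (hP : ContinuousOn P (Icc 0 T ×ˢ Icc (0:ℝ) 1)) (hQ : ContinuousOn Q (Icc 0 T ×ˢ Icc (0:ℝ) 1))
    (hR : ContinuousOn R (Icc 0 T ×ˢ Icc (0:ℝ) 1))
    (hdiv : ∀ p ∈ Ioo 0 T ×ˢ Ioo (0:ℝ) 1, ∃ P' Q' : ℝ × ℝ →L[ℝ] ℝ,
      HasFDerivAt P P' p ∧ HasFDerivAt Q Q' p ∧ P' (1, 0) + Q' (0, 1) = R p)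
    (hQ1 : ∀ t ∈ Ioo 0 T, 0 ≤ Q (t, 1)) (hQ0 : ∀ t ∈ Ioo 0 T, Q (t, 0) ≤ 0)
    (hPT : ∀ x ∈ Icc (0:ℝ) 1, 0 ≤ P (T, x)) (hP0 : ∀ x ∈ Icc (0:ℝ) 1, P (0, x) ≤ C) :
    -C ≤ ∫ p in Icc 0 T ×ˢ Icc (0:ℝ) 1, R p := by
  have hae : (Ioo 0 T ×ˢ Ioo (0:ℝ) 1 : Set (ℝ × ℝ)) =ᵐ[volume] (Icc 0 T ×ˢ Icc (0:ℝ) 1) :=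
    Measure.set_prod_ae_eq Ioo_ae_eq_Icc Ioo_ae_eq_Icc
  have hmeas : MeasurableSet (Ioo 0 T ×ˢ Ioo (0:ℝ) 1) := measurableSet_Ioo.prod measurableSet_Ioo
  have hder : ∀ p ∈ Ioo 0 T ×ˢ Ioo (0:ℝ) 1, HasFDerivAt P (fderiv ℝ P p) p ∧
      HasFDerivAt Q (fderiv ℝ Q p) p ∧ fderiv ℝ P p (1, 0) + fderiv ℝ Q p (0, 1) = R p := by
    intro p hp
    obtain ⟨P', Q', h1, h2, h3⟩ := hdiv p hp
    rw [h1.fderiv, h2.fderiv]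
    exact ⟨h1, h2, h3⟩
  have hRint : IntegrableOn R (Icc 0 T ×ˢ Icc (0:ℝ) 1) :=
    hR.integrableOn_compact (isCompact_Icc.prod isCompact_Icc)
  have hint : IntegrableOn (fun p => fderiv ℝ P p (1, 0) + fderiv ℝ Q p (0, 1))
      (Icc 0 T ×ˢ Icc (0:ℝ) 1) := by
    rw [← integrableOn_congr_set_ae hae] at hRint ⊢
    exact hRint.congr_fun (fun p hp => (hder p hp).2.2.symm) hmeas
  have hRdiv : ∫ p in Icc 0 T ×ˢ Icc (0:ℝ) 1, R p =
      ∫ p in Icc 0 T ×ˢ Icc (0:ℝ) 1, (fderiv ℝ P p (1, 0) + fderiv ℝ Q p (0, 1)) := by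
    rw [← setIntegral_congr_set hae, ← setIntegral_congr_set hae]
    exact setIntegral_congr_fun hmeas fun p hp => (hder p hp).2.2.symm
  have hbox : Icc ((0:ℝ), (0:ℝ)) (T, 1) = Icc 0 T ×ˢ Icc (0:ℝ) 1 := Icc_prod_eq _ _
  have key := integral_divergence_prod_Icc_of_hasFDerivAt_of_le P Q (fderiv ℝ P) (fderiv ℝ Q)
    (0, 0) (T, 1) ⟨hT.le, zero_le_one⟩ (hbox ▸ hP) (hbox ▸ hQ)
    (fun p hp => (hder p hp).1) (fun p hp => (hder p hp).2.1) (hbox ▸ hint)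
  rw [hbox] at key
  rw [hRdiv, key]
  dsimp only
  have hQint : ∀ x ∈ Icc (0:ℝ) 1, IntervalIntegrable (fun t => Q (t, x)) volume 0 T := by
    intro x hx
    apply ContinuousOn.intervalIntegrable_of_Icc hT.le
    exact hQ.comp (by fun_prop) fun t ht => ⟨ht, hx⟩
  have hPint : ∀ t ∈ Icc 0 T, IntervalIntegrable (fun x => P (t, x)) volume 0 1 := by
    intro t ht
    apply ContinuousOn.intervalIntegrable_of_Icc zero_le_one
    exact hP.comp (by fun_prop) fun x hx => ⟨ht, hx⟩
  have i1 : ∫ _ in (0:ℝ)..T, (0:ℝ) ≤ ∫ t in (0:ℝ)..T, Q (t, 1) :=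
    integral_mono_on_of_le_Ioo hT.le (by simp) (hQint 1 (by simp)) hQ1
  have i2 : ∫ t in (0:ℝ)..T, Q (t, 0) ≤ ∫ _ in (0:ℝ)..T, (0:ℝ) :=
    integral_mono_on_of_le_Ioo hT.le (hQint 0 (by simp)) (by simp) hQ0
  have i3 : ∫ _ in (0:ℝ)..1, (0:ℝ) ≤ ∫ x in (0:ℝ)..1, P (T, x) :=
    integral_mono_on zero_le_one (by simp) (hPint T (by simp [hT.le])) hPT
  have i4 : ∫ x in (0:ℝ)..1, P (0, x) ≤ ∫ _ in (0:ℝ)..1, C :=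
    integral_mono_on zero_le_one (hPint 0 (by simp [hT.le])) (by simp) hP0
  simp only [intervalIntegral.integral_const, intervalIntegral.integral_zero, sub_zero,
    one_smul] at i1 i2 i3 i4
  linarith

/-- The derivative of the regularised entropy `s ^ 3 / 6 + (s + δ) log (s + δ) - s`. -/
noncomputable def entropyDeriv (δ s : ℝ) : ℝ := s ^ 2 / 2 + Real.log (s + δ)

/-- The entropy of `s` relative to `r`. -/
noncomputable def relEntropy (δ s r : ℝ) : ℝ :=
  (s ^ 3 - r ^ 3) / 6 - r ^ 2 / 2 * (s - r)
    + (s + δ) * (Real.log (s + δ) - Real.log (r + δ)) - (s - r)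

theorem relEntropy_self (δ r : ℝ) : relEntropy δ r r = 0 := by simp [relEntropy]

theorem div_le_log_sub_log {a b : ℝ} (ha : 0 < a) (hb : 0 < b) :
    (a - b) / a ≤ Real.log a - Real.log b := by
  have h := Real.log_le_sub_one_of_pos (div_pos hb ha)
  rw [Real.log_div hb.ne' ha.ne'] at h
  rw [sub_div, div_self ha.ne']
  linarith

theorem log_sub_log_le_div {a b : ℝ} (ha : 0 < a) (hb : 0 < b) :
    Real.log a - Real.log b ≤ (a - b) / b := by
  have h := Real.log_le_sub_one_of_pos (div_pos ha hb)
  rw [Real.log_div ha.ne' hb.ne'] at h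
  rw [sub_div, div_self hb.ne']
  linarith

theorem le_relEntropy {δ s r : ℝ} (hδ : 0 < δ) (hs : 0 ≤ s) (hr : 0 < r) :
    r / 3 * (s - r) ^ 2 ≤ relEntropy δ s r := by
  have h := mul_le_mul_of_nonneg_left
    (div_le_log_sub_log (a := s + δ) (b := r + δ) (by positivity) (by positivity))
    (by positivity : 0 ≤ s + δ)
  rw [mul_div_cancel₀ _ (by positivity)] at h
  have h2 : 0 ≤ s * (s - r) ^ 2 := by positivity
  unfold relEntropy
  nlinarith

theorem relEntropy_nonneg {δ s r : ℝ} (hδ : 0 < δ) (hs : 0 ≤ s) (hr : 0 < r) :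
    0 ≤ relEntropy δ s r :=
  le_trans (by positivity) (le_relEntropy hδ hs hr)

theorem relEntropy_le {δ s r : ℝ} (hδ : 0 < δ) (hs : 0 ≤ s) (hr : 0 < r) :
    relEntropy δ s r ≤ (s - r) ^ 2 * ((s + 2 * r) / 6 + 1 / r) := by
  have h := mul_le_mul_of_nonneg_left
    (log_sub_log_le_div (a := s + δ) (b := r + δ) (by positivity) (by positivity))
    (by positivity : 0 ≤ s + δ)
  have h1 : (s + δ) * ((s + δ - (r + δ)) / (r + δ)) = (s - r) + (s - r) ^ 2 * (1 / (r + δ)) := by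
    field_simp
    ring
  have h2 : (s - r) ^ 2 * (1 / (r + δ)) ≤ (s - r) ^ 2 * (1 / r) := by
    gcongr
    linarith
  unfold relEntropy
  nlinarith

theorem relEntropy_le_of_bounds {δ s r b B S : ℝ} (hδ : 0 < δ) (hs : 0 ≤ s) (hsS : s ≤ S)
    (hb : 0 < b) (hr : b ≤ r) (hrB : r ≤ B) :
    relEntropy δ s r ≤ (S + B) ^ 2 * ((S + 2 * B) / 6 + 1 / b) := by
  have hr0 : 0 < r := hb.trans_le hr
  refine (relEntropy_le hδ hs hr0).trans ?_
  have h1 : (s - r) ^ 2 ≤ (S + B) ^ 2 := by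
    apply sq_le_sq'
    · linarith
    · linarith
  gcongr

theorem HasFDerivAt.relEntropy {E : Type*} [NormedAddCommGroup E] [NormedSpace ℝ E]
    {U F : E → ℝ} {U' F' : E →L[ℝ] ℝ} {p : E} {δ : ℝ}
    (hU : HasFDerivAt U U' p) (hF : HasFDerivAt F F' p) (hUp : 0 < U p + δ) (hFp : 0 < F p + δ) :
    HasFDerivAt (fun q => relEntropy δ (U q) (F q))
      ((entropyDeriv δ (U p) - entropyDeriv δ (F p)) • U'
        - ((F p + 1 / (F p + δ)) * (U p - F p)) • F') p := by
  have hUd := hU.add_const δ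
  have hFd := hF.add_const δ
  have h := (((((hU.pow 3).sub (hF.pow 3)).mul_const (1 / 6)).sub
    (((hF.pow 2).mul_const (1 / 2)).mul (hU.sub hF))).add
    (hUd.mul ((hUd.log hUp.ne').sub (hFd.log hFp.ne')))).sub (hU.sub hF)
  refine (h.congr_fderiv ?_).congr_of_eventuallyEq ?_
  · ext w
    simp [entropyDeriv]
    field_simp
    ring
  · refine Filter.Eventually.of_forall fun q => ?_
    simp [_root_.relEntropy]
    ring

/-- The production of entropy controls the square of the difference, whatever `α ∈ [-1,1]` is. -/
theorem sq_sub_le_entropy_production {α δ s w : ℝ} (hα : α ∈ Icc (-1:ℝ) 1) (hδ : 0 < δ)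
    (hs : 0 ≤ s) (hw : 0 ≤ w) (hsw : δ ≤ s + w) :
    (s - w) ^ 2 / 2 ≤ (s + w) ^ α * ((s - w) * (entropyDeriv δ s - entropyDeriv δ w)) := by
  wlog h : w ≤ s generalizing s w
  · have := this hw hs (by linarith) (by linarith)
    rw [add_comm w s] at this
    linarith
  have hρ : 0 < s + w := hδ.trans_le hsw
  have hlog : (s - w) / (2 * (s + w)) ≤ Real.log (s + δ) - Real.log (w + δ) := by
    have h1 := div_le_log_sub_log (a := s + δ) (b := w + δ) (by positivity) (by positivity)
    refine le_trans ?_ h1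
    rw [add_sub_add_right_eq_sub]
    apply div_le_div_of_nonneg_left <;> linarith
  have hg : (s - w) * ((s + w) + (s + w)⁻¹) / 2 ≤ entropyDeriv δ s - entropyDeriv δ w := by
    have : (s - w) * ((s + w) + (s + w)⁻¹) / 2
        = (s ^ 2 - w ^ 2) / 2 + (s - w) / (2 * (s + w)) := by
      field_simp
      ring
    rw [this]
    unfold entropyDeriv
    linarith
  have hpow : 1 ≤ (s + w) ^ α * ((s + w) + (s + w)⁻¹) := by
    rw [mul_add, ← Real.rpow_add_one hρ.ne', ← div_eq_mul_inv, ← Real.rpow_sub_one hρ.ne']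
    have p1 := Real.rpow_pos_of_pos hρ (α + 1)
    have p2 := Real.rpow_pos_of_pos hρ (α - 1)
    rcases le_total 1 (s + w) with h1 | h1
    · have := Real.one_le_rpow h1 (by linarith [hα.1] : 0 ≤ α + 1)
      linarith
    · have := Real.one_le_rpow_of_pos_of_le_one_of_nonpos hρ h1
        (by linarith [hα.2] : α - 1 ≤ 0)
      linarith
  calc (s - w) ^ 2 / 2 ≤ (s - w) ^ 2 / 2 * ((s + w) ^ α * ((s + w) + (s + w)⁻¹)) :=
        le_mul_of_one_le_right (by positivity) hpow
    _ = (s + w) ^ α * ((s - w) * ((s - w) * ((s + w) + (s + w)⁻¹) / 2)) := by ring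
    _ ≤ _ := by
        have : 0 ≤ s - w := by linarith
        gcongr

/-- Pointwise bound on the divergence of the weighted relative entropy. -/
theorem entropy_balance_le {α δ ε b B C s w r rt rx : ℝ} (hα : α ∈ Icc (-1:ℝ) 1) (hδ : 0 < δ)
    (hε : 0 < ε) (hs : 0 ≤ s) (hw : 0 ≤ w) (hsw : δ ≤ s + w) (hb : 0 < b) (hr : b ≤ r)
    (hrB : r ≤ B) (ht : |rt| ≤ C) (hx : |rx| ≤ C) :
    -(3 / b) * (relEntropy δ s r + relEntropy δ w r)
      - (s + w) ^ α * ((s - w) * (entropyDeriv δ s - entropyDeriv δ w)) / ε ^ 2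
      - (r + 1 / (r + δ)) * (rt * ((s - r) + (w - r)) + rx * ((s - w) / ε))
    ≤ 2 * ((B + 1 / b) * C) ^ 2 - ((s - w) / ε) ^ 2 / 4 := by
  have hr0 : 0 < r := hb.trans_le hr
  have hk : r + 1 / (r + δ) ≤ B + 1 / b := by
    gcongr
    linarith
  have hk0 : 0 < r + 1 / (r + δ) := by positivity
  have hk1 : 0 ≤ B + 1 / b := (hk0.trans_le hk).le
  have hent : ∀ {z : ℝ}, 0 ≤ z → (z - r) ^ 2 ≤ 3 / b * relEntropy δ z r := by
    intro z hz
    have h1 := le_relEntropy hδ hz hr0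
    have h2 : b / 3 * (z - r) ^ 2 ≤ r / 3 * (z - r) ^ 2 := by gcongr
    calc (z - r) ^ 2 = 3 / b * (b / 3 * (z - r) ^ 2) := by field_simp
      _ ≤ _ := by gcongr; exact h2.trans h1
  have hprod : ((s - w) / ε) ^ 2 / 2
      ≤ (s + w) ^ α * ((s - w) * (entropyDeriv δ s - entropyDeriv δ w)) / ε ^ 2 := by
    rw [div_pow, div_right_comm]
    gcongr
    exact sq_sub_le_entropy_production hα hδ hs hw hsw
  have hsq : ∀ {z : ℝ}, |z| ≤ C → ((r + 1 / (r + δ)) * z) ^ 2 ≤ ((B + 1 / b) * C) ^ 2 := by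
    intro z hz
    rw [← sq_abs, abs_mul, abs_of_pos hk0]
    gcongr
  have h1 := hent hs
  have h2 := hent hw
  have h3 := hsq ht
  have h4 := hsq hx
  nlinarith [sq_nonneg ((r + 1 / (r + δ)) * rt / 2 + (s - r)),
    sq_nonneg ((r + 1 / (r + δ)) * rt / 2 + (w - r)),
    sq_nonneg ((r + 1 / (r + δ)) * rx + ((s - w) / ε) / 2)]

theorem continuousOn_relEntropy {X : Type*} [TopologicalSpace X] {U F : X → ℝ} {D : Set X} {δ : ℝ}
    (hU : ContinuousOn U D) (hF : ContinuousOn F D) (hUp : ∀ p ∈ D, U p + δ ≠ 0)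
    (hFp : ∀ p ∈ D, F p + δ ≠ 0) : ContinuousOn (fun p => relEntropy δ (U p) (F p)) D := by
  have h1 := (hU.add (continuousOn_const (c := δ))).log hUp
  have h2 := (hF.add (continuousOn_const (c := δ))).log hFp
  unfold relEntropy
  fun_prop

theorem continuousOn_entropyDeriv {X : Type*} [TopologicalSpace X] {U : X → ℝ} {D : Set X} {δ : ℝ}
    (hU : ContinuousOn U D) (hUp : ∀ p ∈ D, U p + δ ≠ 0) :
    ContinuousOn (fun p => entropyDeriv δ (U p)) D := by
  have h1 := (hU.add (continuousOn_const (c := δ))).log hUp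
  unfold entropyDeriv
  fun_prop

theorem HasFDerivAt.deriv_fst {U : ℝ × ℝ → ℝ} {U' : ℝ × ℝ →L[ℝ] ℝ} {t x : ℝ}
    (hU : HasFDerivAt U U' (t, x)) : deriv (fun s => U (s, x)) t = U' (1, 0) :=
  (hU.comp_hasDerivAt t ((hasDerivAt_id t).prodMk (hasDerivAt_const t x))).deriv

theorem HasFDerivAt.deriv_snd {U : ℝ × ℝ → ℝ} {U' : ℝ × ℝ →L[ℝ] ℝ} {t x : ℝ}
    (hU : HasFDerivAt U U' (t, x)) : deriv (fun y => U (t, y)) x = U' (0, 1) :=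
  (hU.comp_hasDerivAt x ((hasDerivAt_const x t).prodMk (hasDerivAt_id x))).deriv

theorem HasDerivAt.hasFDerivAt_lift {φ ψ : ℝ → ℝ} {φ' ψ' t x : ℝ} (hφ : HasDerivAt φ φ' t)
    (hψ : HasDerivAt ψ ψ' t) :
    ∃ F' : ℝ × ℝ →L[ℝ] ℝ,
      HasFDerivAt (fun p : ℝ × ℝ => (1 - p.2) * φ p.1 + p.2 * ψ p.1) F' (t, x) ∧
      F' (1, 0) = (1 - x) * φ' + x * ψ' ∧ F' (0, 1) = ψ t - φ t := by
  have h1 : HasFDerivAt (fun p : ℝ × ℝ => φ p.1) _ (t, x) :=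
    HasFDerivAt.comp (g := φ) (t, x) hφ.hasFDerivAt hasFDerivAt_fst
  have h2 : HasFDerivAt (fun p : ℝ × ℝ => ψ p.1) _ (t, x) :=
    HasFDerivAt.comp (g := ψ) (t, x) hψ.hasFDerivAt hasFDerivAt_fst
  refine ⟨_, ((hasFDerivAt_snd.const_sub 1).mul h1).add (hasFDerivAt_snd.mul h2), ?_, ?_⟩
  · simp
  · simp
    ring

theorem hasFDerivAt_exp_weight (K t x : ℝ) :
    ∃ W' : ℝ × ℝ →L[ℝ] ℝ, HasFDerivAt (fun p : ℝ × ℝ => Real.exp (-K * p.1)) W' (t, x) ∧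
      W' (1, 0) = -K * Real.exp (-K * t) ∧ W' (0, 1) = 0 := by
  refine ⟨_, (hasFDerivAt_fst.const_mul (-K)).exp, ?_, ?_⟩
  · simp [mul_comm]
  · simp

/-- The balance law of the weighted relative entropy at a point where `u`, `v` solve the system. -/
theorem entropy_balance_hasFDerivAt {α δ ε K : ℝ} (hε : ε ≠ 0) {U V F W : ℝ × ℝ → ℝ}
    {U' V' F' W' : ℝ × ℝ →L[ℝ] ℝ} {p : ℝ × ℝ} (hU : HasFDerivAt U U' p) (hV : HasFDerivAt V V' p)
    (hF : HasFDerivAt F F' p) (hW : HasFDerivAt W W' p) (hUp : 0 < U p + δ) (hVp : 0 < V p + δ)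
    (hFp : 0 < F p + δ) (hWt : W' (1, 0) = -K * W p) (hWx : W' (0, 1) = 0)
    (hu : ε ^ 2 * U' (1, 0) + ε * U' (0, 1) = (U p + V p) ^ α * (V p - U p))
    (hv : ε ^ 2 * V' (1, 0) - ε * V' (0, 1) = (U p + V p) ^ α * (U p - V p)) :
    ∃ P' Q' : ℝ × ℝ →L[ℝ] ℝ,
      HasFDerivAt (fun q => W q * (relEntropy δ (U q) (F q) + relEntropy δ (V q) (F q))) P' p ∧
      HasFDerivAt (fun q => W q * ((relEntropy δ (U q) (F q) - relEntropy δ (V q) (F q)) * ε⁻¹))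
        Q' p ∧
      P' (1, 0) + Q' (0, 1) =
        W p * (-K * (relEntropy δ (U p) (F p) + relEntropy δ (V p) (F p))
          - (U p + V p) ^ α
            * ((U p - V p) * (entropyDeriv δ (U p) - entropyDeriv δ (V p))) / ε ^ 2
          - (F p + 1 / (F p + δ)) * (F' (1, 0) * ((U p - F p) + (V p - F p))
            + F' (0, 1) * ((U p - V p) / ε))) := by
  have hru := hU.relEntropy hF hUp hFp
  have hrv := hV.relEntropy hF hVp hFp
  refine ⟨_, _, hW.mul (hru.add hrv), hW.mul ((hru.sub hrv).mul_const ε⁻¹), ?_⟩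
  have hut : U' (1, 0) = ((U p + V p) ^ α * (V p - U p) - ε * U' (0, 1)) / ε ^ 2 := by
    rw [← hu]
    field_simp
    ring
  have hvt : V' (1, 0) = ((U p + V p) ^ α * (U p - V p) + ε * V' (0, 1)) / ε ^ 2 := by
    rw [← hv]
    field_simp
    ring
  simp [hWt, hWx, hut, hvt]
  field_simp
  ring

/-- The bound on the current in terms of bounds on the data. -/
theorem current_sq_integral_le {α T ε b B C S : ℝ} (hα : α ∈ Icc (-1:ℝ) 1) (hT : 0 < T)
    (hε : 0 < ε) {φm φp uin vin : ℝ → ℝ} {u v : ℝ → ℝ → ℝ}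
    (hm : ContDiffOn ℝ 1 φm (Icc 0 T)) (hp : ContDiffOn ℝ 1 φp (Icc 0 T)) (hb : 0 < b)
    (hmB : ∀ t ∈ Icc 0 T, b ≤ φm t ∧ φm t ≤ B) (hpB : ∀ t ∈ Icc 0 T, b ≤ φp t ∧ φp t ≤ B)
    (hmC : ∀ t ∈ Icc 0 T, |derivWithin φm (Icc 0 T) t| ≤ C)
    (hpC : ∀ t ∈ Icc 0 T, |derivWithin φp (Icc 0 T) t| ≤ C)
    (hBC : B ≤ C) (hS : ∀ x ∈ Icc (0:ℝ) 1, uin x ≤ S ∧ vin x ≤ S)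
    (hsol : IsScaledCarlemanSol α T ε φm φp uin vin u v) :
    (∫ t in (0:ℝ)..T, ∫ x in (0:ℝ)..1, ((u t x - v t x) / ε) ^ 2) ≤
      4 * Real.exp (3 / b * T) * (2 * ((B + 1 / b) * C) ^ 2 * T
        + 2 * ((S + B) ^ 2 * ((S + 2 * B) / 6 + 1 / b))) := by
  obtain ⟨hu1, hv1, hpos, heq, hbc, hic⟩ := hsol
  set D : Set (ℝ × ℝ) := Icc 0 T ×ˢ Icc (0:ℝ) 1 with hD
  have hDc : IsCompact D := isCompact_Icc.prod isCompact_Icc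
  have hposD : ∀ p ∈ D, 0 ≤ u p.1 p.2 ∧ 0 ≤ v p.1 p.2 ∧ 0 < u p.1 p.2 + v p.1 p.2 :=
    fun p hp => hpos p.1 hp.1 p.2 hp.2
  have huc := hu1.continuousOn
  have hvc := hv1.continuousOn
  obtain ⟨δ, hδ, hδD⟩ : ∃ δ, 0 < δ ∧ ∀ p ∈ D, δ ≤ u p.1 p.2 + v p.1 p.2 := by
    obtain ⟨p, hpD, hpmin⟩ := hDc.exists_isMinOn ⟨(0, 0), by simp [hD, hT.le]⟩ (huc.add hvc)
    exact ⟨_, (hposD p hpD).2.2, fun q hq => hpmin hq⟩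
  set F : ℝ × ℝ → ℝ := fun p => (1 - p.2) * φm p.1 + p.2 * φp p.1 with hFdef
  have hfst : MapsTo Prod.fst D (Icc 0 T) := fun p hp => hp.1
  have hmc : ContinuousOn (fun p : ℝ × ℝ => φm p.1) D :=
    hm.continuousOn.comp continuousOn_fst hfst
  have hpc : ContinuousOn (fun p : ℝ × ℝ => φp p.1) D :=
    hp.continuousOn.comp continuousOn_fst hfst
  have hmd : ContinuousOn (fun p : ℝ × ℝ => derivWithin φm (Icc 0 T) p.1) D :=
    (hm.continuousOn_derivWithin (uniqueDiffOn_Icc hT) le_rfl).comp continuousOn_fst hfst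
  have hpd : ContinuousOn (fun p : ℝ × ℝ => derivWithin φp (Icc 0 T) p.1) D :=
    (hp.continuousOn_derivWithin (uniqueDiffOn_Icc hT) le_rfl).comp continuousOn_fst hfst
  have hFc : ContinuousOn F D :=
    ((continuousOn_const.sub continuousOn_snd).mul hmc).add (continuousOn_snd.mul hpc)
  have hFB : ∀ p ∈ D, b ≤ F p ∧ F p ≤ B := by
    intro p ⟨hpt, hpx0, hpx1⟩
    have h1 := hmB _ hpt
    have h2 := hpB _ hpt
    constructor <;> simp only [hFdef] <;> nlinarith
  set Ft : ℝ × ℝ → ℝ := fun p =>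
    (1 - p.2) * derivWithin φm (Icc 0 T) p.1 + p.2 * derivWithin φp (Icc 0 T) p.1 with hFt
  set Fx : ℝ × ℝ → ℝ := fun p => φp p.1 - φm p.1 with hFx
  have hFtC : ∀ p ∈ D, |Ft p| ≤ C := by
    intro p ⟨hpt, hpx0, hpx1⟩
    have h1 := abs_le.1 (hmC _ hpt)
    have h2 := abs_le.1 (hpC _ hpt)
    rw [abs_le]
    constructor <;> simp only [hFt] <;> nlinarith
  have hFxC : ∀ p ∈ D, |Fx p| ≤ C := by
    intro p hp
    have h1 := hmB _ hp.1
    have h2 := hpB _ hp.1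
    rw [abs_le]
    constructor <;> simp only [hFx] <;> linarith
  have hUδ : ∀ p ∈ D, 0 < u p.1 p.2 + δ := fun p hp => by linarith [hposD p hp]
  have hVδ : ∀ p ∈ D, 0 < v p.1 p.2 + δ := fun p hp => by linarith [hposD p hp]
  have hFδ : ∀ p ∈ D, 0 < F p + δ := fun p hp => by linarith [hFB p hp]
  have hru := continuousOn_relEntropy huc hFc (fun p hp => (hUδ p hp).ne')
    (fun p hp => (hFδ p hp).ne')
  have hrv := continuousOn_relEntropy hvc hFc (fun p hp => (hVδ p hp).ne')
    (fun p hp => (hFδ p hp).ne')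
  have hgu := continuousOn_entropyDeriv huc (fun p hp => (hUδ p hp).ne')
  have hgv := continuousOn_entropyDeriv hvc (fun p hp => (hVδ p hp).ne')
  have hpow : ContinuousOn (fun p : ℝ × ℝ => (u p.1 p.2 + v p.1 p.2) ^ α) D :=
    (huc.add hvc).rpow_const fun p hp => Or.inl (hposD p hp).2.2.ne'
  have hinv : ContinuousOn (fun p => 1 / (F p + δ)) D :=
    continuousOn_const.div (hFc.add continuousOn_const) fun p hp => (hFδ p hp).ne'
  have hFtc : ContinuousOn Ft D := by
    rw [hFt]
    fun_prop
  have hFxc : ContinuousOn Fx D := hpc.sub hmc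
  set K := 3 / b with hK
  have hK0 : 0 < K := by positivity
  set R : ℝ × ℝ → ℝ := fun p => Real.exp (-K * p.1) *
    (-K * (relEntropy δ (u p.1 p.2) (F p) + relEntropy δ (v p.1 p.2) (F p))
      - (u p.1 p.2 + v p.1 p.2) ^ α * ((u p.1 p.2 - v p.1 p.2)
        * (entropyDeriv δ (u p.1 p.2) - entropyDeriv δ (v p.1 p.2))) / ε ^ 2
      - (F p + 1 / (F p + δ)) * (Ft p * ((u p.1 p.2 - F p) + (v p.1 p.2 - F p))
        + Fx p * ((u p.1 p.2 - v p.1 p.2) / ε))) with hRdef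
  have hRc : ContinuousOn R D := by fun_prop
  have hj : ContinuousOn (fun p : ℝ × ℝ => ((u p.1 p.2 - v p.1 p.2) / ε) ^ 2) D := by fun_prop
  have hlow : -(2 * ((S + B) ^ 2 * ((S + 2 * B) / 6 + 1 / b))) ≤ ∫ p in D, R p := by
    refine neg_le_integral_divergence hT
      (P := fun p => Real.exp (-K * p.1)
        * (relEntropy δ (u p.1 p.2) (F p) + relEntropy δ (v p.1 p.2) (F p)))
      (Q := fun p => Real.exp (-K * p.1)
        * ((relEntropy δ (u p.1 p.2) (F p) - relEntropy δ (v p.1 p.2) (F p)) * ε⁻¹))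
      (by fun_prop) (by fun_prop) hRc ?_ ?_ ?_ ?_ ?_
    · rintro ⟨t, x⟩ ⟨ht, hx⟩
      dsimp only at ht hx
      have hpD : (t, x) ∈ D := ⟨Ioo_subset_Icc_self ht, Ioo_subset_Icc_self hx⟩
      have hnhds : D ∈ nhds (t, x) := prod_mem_nhds (Icc_mem_nhds ht.1 ht.2)
        (Icc_mem_nhds hx.1 hx.2)
      have hder : ∀ {φ : ℝ → ℝ}, ContDiffOn ℝ 1 φ (Icc 0 T) →
          HasDerivAt φ (derivWithin φ (Icc 0 T) t) t := fun hφ =>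
        ((hφ.differentiableOn one_ne_zero t (Ioo_subset_Icc_self ht)).hasDerivWithinAt).hasDerivAt
          (Icc_mem_nhds ht.1 ht.2)
      have hU := ((hu1.contDiffAt hnhds).differentiableAt one_ne_zero).hasFDerivAt
      have hV := ((hv1.contDiffAt hnhds).differentiableAt one_ne_zero).hasFDerivAt
      obtain ⟨F', hF, hF1, hF2⟩ := (hder hm).hasFDerivAt_lift (x := x) (hder hp)
      obtain ⟨W', hW, hW1, hW2⟩ := hasFDerivAt_exp_weight K t x
      obtain ⟨h1, h2⟩ := heq t ht x hx
      rw [hU.deriv_fst, hU.deriv_snd] at h1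
      rw [hV.deriv_fst, hV.deriv_snd] at h2
      obtain ⟨P', Q', hP, hQ, hPQ⟩ := entropy_balance_hasFDerivAt hε.ne' hU hV hF hW
        (hUδ _ hpD) (hVδ _ hpD) (hFδ _ hpD) hW1 hW2 h1 h2
      rw [hF1, hF2] at hPQ
      exact ⟨P', Q', hP, hQ, hPQ⟩
    · intro t ht
      have hpD : (t, (1:ℝ)) ∈ D := ⟨Ioo_subset_Icc_self ht, by simp⟩
      have hv' : F (t, 1) = v t 1 := by simp [hFdef, (hbc t ht).2]
      have := relEntropy_nonneg hδ (hposD _ hpD).1 (hb.trans_le (hFB _ hpD).1)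
      rw [hv'] at this ⊢
      dsimp only at this ⊢
      rw [relEntropy_self, sub_zero]
      positivity
    · intro t ht
      have hpD : (t, (0:ℝ)) ∈ D := ⟨Ioo_subset_Icc_self ht, by simp⟩
      have hu' : F (t, 0) = u t 0 := by simp [hFdef, (hbc t ht).1]
      have := relEntropy_nonneg hδ (hposD _ hpD).2.1 (hb.trans_le (hFB _ hpD).1)
      rw [hu'] at this ⊢
      dsimp only at this ⊢
      rw [relEntropy_self, zero_sub, neg_mul (relEntropy _ _ _), mul_neg, neg_nonpos]
      positivity
    · intro x hx
      have hpD : (T, x) ∈ D := ⟨by simp [hT.le], hx⟩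
      have hF0 := hb.trans_le (hFB _ hpD).1
      have h1 := relEntropy_nonneg hδ (hposD _ hpD).1 hF0
      have h2 := relEntropy_nonneg hδ (hposD _ hpD).2.1 hF0
      positivity
    · intro x hx
      have hpD : ((0:ℝ), x) ∈ D := ⟨by simp [hT.le], hx⟩
      obtain ⟨hF1, hF2⟩ := hFB _ hpD
      obtain ⟨hx1, hx2⟩ := hic x hx
      have h1 := relEntropy_le_of_bounds hδ (hposD _ hpD).1
        (by simpa [hx1] using (hS x hx).1) hb hF1 hF2
      have h2 := relEntropy_le_of_bounds hδ (hposD _ hpD).2.1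
        (by simpa [hx2] using (hS x hx).2) hb hF1 hF2
      dsimp only at h1 h2 ⊢
      rw [mul_zero, Real.exp_zero, one_mul]
      linarith
  have hup : ∫ p in D, R p ≤ ∫ p in D, (2 * ((B + 1 / b) * C) ^ 2
      - Real.exp (-K * T) / 4 * ((u p.1 p.2 - v p.1 p.2) / ε) ^ 2) := by
    refine setIntegral_mono_on (hRc.integrableOn_compact hDc)
      (ContinuousOn.integrableOn_compact hDc (by fun_prop)) hDc.measurableSet fun p hpD => ?_
    obtain ⟨hu0, hv0, -⟩ := hposD p hpD
    have hbal := entropy_balance_le hα hδ hε hu0 hv0 (hδD p hpD) hb (hFB p hpD).1 (hFB p hpD).2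
      (hFtC p hpD) (hFxC p hpD)
    have he := Real.exp_pos (-K * p.1)
    have he1 : Real.exp (-K * p.1) ≤ 1 := Real.exp_le_one_iff.2 (by nlinarith [hpD.1.1])
    have heT : Real.exp (-K * T) ≤ Real.exp (-K * p.1) :=
      Real.exp_le_exp.2 (by nlinarith [hpD.1.2])
    refine (mul_le_mul_of_nonneg_left hbal he.le).trans ?_
    nlinarith [mul_le_mul_of_nonneg_right heT (sq_nonneg ((u p.1 p.2 - v p.1 p.2) / ε)),
      mul_le_mul_of_nonneg_right he1 (sq_nonneg ((B + 1 / b) * C))]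
  have hvol : volume.real D = T := by
    rw [hD, Measure.volume_eq_prod, measureReal_prod_prod]
    simp [hT.le]
  have hiter : (∫ t in (0:ℝ)..T, ∫ x in (0:ℝ)..1, ((u t x - v t x) / ε) ^ 2)
      = ∫ p in D, ((u p.1 p.2 - v p.1 p.2) / ε) ^ 2 := by
    have := setIntegral_prod (μ := volume) (ν := volume) _ (hj.integrableOn_compact hDc)
    rw [Measure.volume_eq_prod, this]
    simp only [intervalIntegral.integral_of_le hT.le, intervalIntegral.integral_of_le zero_le_one,
      integral_Icc_eq_integral_Ioc]
  have hconst : Integrable (fun _ : ℝ × ℝ => 2 * ((B + 1 / b) * C) ^ 2) (volume.restrict D) :=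
    integrableOn_const hDc.measure_lt_top.ne
  have hjint : Integrable (fun p : ℝ × ℝ => ((u p.1 p.2 - v p.1 p.2) / ε) ^ 2)
      (volume.restrict D) := hj.integrableOn_compact hDc
  rw [MeasureTheory.integral_sub hconst (hjint.const_mul _),
    setIntegral_const, hvol, smul_eq_mul, MeasureTheory.integral_const_mul, ← hiter] at hup
  have hexp : Real.exp (K * T) * Real.exp (-K * T) = 1 := by
    rw [← Real.exp_add]
    simp
  set I := ∫ t in (0:ℝ)..T, ∫ x in (0:ℝ)..1, ((u t x - v t x) / ε) ^ 2
  calc I = 4 * Real.exp (K * T) * (Real.exp (-K * T) / 4 * I) := by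
        linear_combination (-I) * hexp
    _ ≤ _ := by
        gcongr
        linarith

/-- Uniform `L²` bound on the current: for admissible data there is a constant `J`,
independent of `ε`, such that `∫₀ᵀ∫₀¹ j_ε² ≤ J` for every classical solution of the
scaled generalized Carleman system, where `j_ε = (u_ε - v_ε)/ε`. -/
theorem current_uniform_L2_bound
    (α T : ℝ) (hα : α ∈ Set.Icc (-1:ℝ) 1) (hT : 0 < T)
    (φm φp uin vin : ℝ → ℝ) (hdata : AdmissibleData T φm φp uin vin) :
    ∃ J : ℝ, 0 < J ∧ ∀ ε : ℝ, 0 < ε → ∀ u v : ℝ → ℝ → ℝ,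
      IsScaledCarlemanSol α T ε φm φp uin vin u v →
      (∫ t in (0:ℝ)..T, ∫ x in (0:ℝ)..1, ((u t x - v t x) / ε) ^ 2) ≤ J := by
  obtain ⟨hm, hp, hpos, huin, hvin, -⟩ := hdata
  have hne : (Icc 0 T).Nonempty := nonempty_Icc.2 hT.le
  obtain ⟨tm, htm, hbm⟩ := isCompact_Icc.exists_isMinOn hne hm.continuousOn
  obtain ⟨tp, htp, hbp⟩ := isCompact_Icc.exists_isMinOn hne hp.continuousOn
  obtain ⟨Bm, hBm⟩ := isCompact_Icc.exists_bound_of_continuousOn hm.continuousOn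
  obtain ⟨Bp, hBp⟩ := isCompact_Icc.exists_bound_of_continuousOn hp.continuousOn
  obtain ⟨Cm, hCm⟩ := isCompact_Icc.exists_bound_of_continuousOn
    (hm.continuousOn_derivWithin (uniqueDiffOn_Icc hT) le_rfl)
  obtain ⟨Cp, hCp⟩ := isCompact_Icc.exists_bound_of_continuousOn
    (hp.continuousOn_derivWithin (uniqueDiffOn_Icc hT) le_rfl)
  obtain ⟨Su, hSu⟩ := isCompact_Icc.exists_bound_of_continuousOn huin
  obtain ⟨Sv, hSv⟩ := isCompact_Icc.exists_bound_of_continuousOn hvin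
  refine ⟨max 1 _, lt_max_of_lt_left one_pos, fun ε hε u v hsol => le_max_of_le_right
    (current_sq_integral_le (b := min (φm tm) (φp tp)) (B := max Bm Bp)
      (C := max (max Cm Cp) (max Bm Bp)) (S := max Su Sv) hα hT hε hm hp
      (lt_min (hpos tm htm).1 (hpos tp htp).2) (fun t ht => ?_) (fun t ht => ?_) (fun t ht => ?_)
      (fun t ht => ?_) (le_max_right _ _) (fun x hx => ?_) hsol)⟩
  · exact ⟨min_le_of_left_le (hbm ht), le_max_of_le_left ((le_abs_self _).trans (hBm t ht))⟩
  · exact ⟨min_le_of_right_le (hbp ht), le_max_of_le_right ((le_abs_self _).trans (hBp t ht))⟩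
  · exact le_max_of_le_left (le_max_of_le_left (hCm t ht))
  · exact le_max_of_le_left (le_max_of_le_right (hCp t ht))
  · exact ⟨le_max_of_le_left ((le_abs_self _).trans (hSu x hx)),
      le_max_of_le_right ((le_abs_self _).trans (hSv x hx))⟩
end

section
/- Fix α ∈ [-1,1], T > 0 and admissible data (u_in, v_in, φ⁻, φ⁺). Then there exists a constant K > 0, depending only on α, T, φ⁻, φ⁺, u_in, v_in (and not on ε), such that for every ε > 0 and every classical solution (u_ε, v_ε) on [0,T] of the scaled generalized Carleman system with these data, the macroscopic density ρ_ε = u_ε + v_ε satisfies ∫₀ᵀ ∫₀¹ ρ_ε(t,x)² dx dt ≤ K. -/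
open MeasureTheory Set intervalIntegral

/-- If `f z - η z.1` is maximal over `Q` at `z₀` and `z₀` can be reached from the interior of `Q` in
the direction `d`, then the derivative of `f` in the direction `d`, extended by continuity to `z₀`,
is at least `η d.1`. -/
theorem mul_fst_le_of_maximal_of_fderiv_eq {Q : Set (ℝ × ℝ)} {f R : ℝ × ℝ → ℝ} {z₀ d : ℝ × ℝ}
    {δ η : ℝ} (hδ : 0 < δ) (hz₀ : z₀ ∈ Q)
    (hin : ∀ s ∈ Set.Ioo 0 δ, z₀ - s • d ∈ interior Q)
    (hf : ContDiffOn ℝ 1 f Q) (hR : ContinuousWithinAt R Q z₀)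
    (hD : ∀ z ∈ interior Q, fderiv ℝ f z d = R z)
    (hmax : ∀ z ∈ Q, f z - η * z.1 ≤ f z₀ - η * z₀.1) :
    η * d.1 ≤ R z₀ := by
  by_contra! hlt
  have hγ : Continuous fun s : ℝ => z₀ - s • d := by fun_prop
  have hmaps : Set.MapsTo (fun s : ℝ => z₀ - s • d) (Set.Ico 0 δ) Q := by
    intro s hs
    rcases hs.1.eq_or_lt with h | h
    · simpa [← h] using hz₀
    · exact interior_subset (hin s ⟨h, hs.2⟩)
  have hcomp : ContinuousWithinAt (fun s : ℝ => R (z₀ - s • d)) (Set.Ico 0 δ) 0 := by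
    refine ContinuousWithinAt.comp (t := Q) (g := R) ?_ hγ.continuousWithinAt hmaps
    simpa using hR
  have hev : ∀ᶠ s in nhdsWithin (0 : ℝ) (Set.Ico 0 δ), R (z₀ - s • d) < η * d.1 :=
    hcomp.eventually_lt_const (by simpa using hlt)
  obtain ⟨r, hr, hball⟩ := Metric.mem_nhdsWithin_iff.1 hev
  obtain ⟨s₁, hs₁, hs₁'⟩ := exists_between (lt_min hr hδ)
  have hsub : Set.Icc 0 s₁ ⊆ Set.Ico 0 δ := fun s hs =>
    ⟨hs.1, hs.2.trans_lt (hs₁'.trans_le (min_le_right _ _))⟩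
  have hmono : StrictMonoOn (fun s : ℝ => f (z₀ - s • d) + η * d.1 * s) (Set.Icc 0 s₁) := by
    refine strictMonoOn_of_deriv_pos (convex_Icc _ _) ?_ ?_
    · exact (hf.continuousOn.comp hγ.continuousOn (hmaps.mono_left hsub)).add (by fun_prop)
    · intro s hs
      rw [interior_Icc] at hs
      have hs' : s ∈ Set.Ico 0 δ := hsub ⟨hs.1.le, hs.2.le⟩
      have hint := hin s ⟨hs.1, hs'.2⟩
      have hfd : HasFDerivAt f (fderiv ℝ f (z₀ - s • d)) (z₀ - s • d) :=
        ((hf.contDiffAt (mem_interior_iff_mem_nhds.1 hint)).differentiableAt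
          (by norm_num)).hasFDerivAt
      have hγ' : HasDerivAt (fun s : ℝ => z₀ - s • d) (-d) s := by
        simpa using ((hasDerivAt_id s).smul_const d).const_sub z₀
      have h := (hfd.comp_hasDerivAt s hγ').add ((hasDerivAt_id s).const_mul (η * d.1))
      have hlt' : R (z₀ - s • d) < η * d.1 := by
        refine hball ⟨?_, hs'⟩
        rw [Metric.mem_ball, Real.dist_eq, sub_zero, abs_of_pos hs.1]
        exact hs.2.trans (hs₁'.trans_le (min_le_left _ _))
      have h' : deriv (fun s : ℝ => f (z₀ - s • d) + η * d.1 * s) s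
          = -R (z₀ - s • d) + η * d.1 := by
        refine Eq.trans h.deriv ?_
        rw [map_neg, hD _ hint, mul_one]
      rw [h']
      linarith
  have h := hmono (Set.left_mem_Icc.2 hs₁.le) (Set.right_mem_Icc.2 hs₁.le) hs₁
  have hm := hmax _ (hmaps (hsub (Set.right_mem_Icc.2 hs₁.le)))
  simp only [zero_smul, sub_zero, mul_zero, add_zero, Prod.fst_sub, Prod.smul_fst,
    smul_eq_mul] at h hm
  linarith

/-- The derivative of a function of two variables in the direction `(a, b)` in terms of its
partial derivatives. -/
theorem fderiv_uncurry_apply {w : ℝ → ℝ → ℝ} {z : ℝ × ℝ} (a b : ℝ)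
    (hw : DifferentiableAt ℝ (fun p : ℝ × ℝ => w p.1 p.2) z) :
    fderiv ℝ (fun p : ℝ × ℝ => w p.1 p.2) z (a, b)
      = a * deriv (fun s => w s z.2) z.1 + b * deriv (fun y => w z.1 y) z.2 := by
  have h1 : HasDerivAt (fun s => w s z.2)
      (fderiv ℝ (fun p : ℝ × ℝ => w p.1 p.2) z (1, 0)) z.1 :=
    HasFDerivAt.comp_hasDerivAt (f := fun s : ℝ => (s, z.2)) z.1 hw.hasFDerivAt
      ((hasDerivAt_id z.1).prodMk (hasDerivAt_const z.1 z.2))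
  have h2 : HasDerivAt (fun y => w z.1 y)
      (fderiv ℝ (fun p : ℝ × ℝ => w p.1 p.2) z (0, 1)) z.2 :=
    HasFDerivAt.comp_hasDerivAt (f := fun y : ℝ => (z.1, y)) z.2 hw.hasFDerivAt
      ((hasDerivAt_const z.2 z.1).prodMk (hasDerivAt_id z.2))
  rw [h1.deriv, h2.deriv, ← smul_eq_mul, ← smul_eq_mul, ← map_smul, ← map_smul, ← map_add]
  simp

/-- Maximum principle: a classical solution of the scaled Carleman system is bounded by any common
upper bound of its initial and inflow data. -/
theorem IsScaledCarlemanSol.le_of_data_le {α T ε M : ℝ} {φm φp uin vin : ℝ → ℝ}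
    {u v : ℝ → ℝ → ℝ} (hT : 0 < T) (hε : 0 < ε)
    (h : IsScaledCarlemanSol α T ε φm φp uin vin u v)
    (hφ : ∀ t ∈ Set.Icc 0 T, φm t ≤ M ∧ φp t ≤ M)
    (hin : ∀ x ∈ Set.Icc (0:ℝ) 1, uin x ≤ M ∧ vin x ≤ M) :
    ∀ t ∈ Set.Icc 0 T, ∀ x ∈ Set.Icc (0:ℝ) 1, u t x ≤ M ∧ v t x ≤ M := by
  obtain ⟨hu, hv, hpos, heq, hbd, hinit⟩ := h
  set Q : Set (ℝ × ℝ) := Set.Icc 0 T ×ˢ Set.Icc (0:ℝ) 1 with hQ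
  have hQint : interior Q = Set.Ioo 0 T ×ˢ Set.Ioo (0:ℝ) 1 := by
    rw [hQ, interior_prod_eq, interior_Icc, interior_Icc]
  have hcl : closure (Set.Ioo 0 T) = Set.Icc 0 T := closure_Ioo hT.ne
  have hu0 : ∀ t ∈ Set.Icc 0 T, u t 0 ≤ M := by
    rw [← hcl]
    refine le_on_closure (fun t ht => ?_) ?_ continuousOn_const
    · rw [(hbd t ht).1]
      exact (hφ t (Set.Ioo_subset_Icc_self ht)).1
    · rw [hcl]
      exact hu.continuousOn.comp (f := fun t : ℝ => (t, (0:ℝ))) (by fun_prop)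
        fun t ht => ⟨ht, by simp⟩
  have hv1 : ∀ t ∈ Set.Icc 0 T, v t 1 ≤ M := by
    rw [← hcl]
    refine le_on_closure (fun t ht => ?_) ?_ continuousOn_const
    · rw [(hbd t ht).2]
      exact (hφ t (Set.Ioo_subset_Icc_self ht)).2
    · rw [hcl]
      exact hv.continuousOn.comp (f := fun t : ℝ => (t, (1:ℝ))) (by fun_prop)
        fun t ht => ⟨ht, by simp⟩
  have hρ : ContinuousOn (fun p : ℝ × ℝ => (u p.1 p.2 + v p.1 p.2) ^ α) Q :=
    (hu.continuousOn.add hv.continuousOn).rpow_const fun p hp =>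
      Or.inl (hpos p.1 hp.1 p.2 hp.2).2.2.ne'
  have hρ0 : ∀ p ∈ Q, 0 ≤ (u p.1 p.2 + v p.1 p.2) ^ α := fun p hp =>
    Real.rpow_nonneg (hpos p.1 hp.1 p.2 hp.2).2.2.le α
  have key : ∀ η : ℝ, 0 < η → ∀ p ∈ Q, max (u p.1 p.2) (v p.1 p.2) ≤ M + η * T := by
    intro η hη p hp
    obtain ⟨z, hz, hzmax⟩ := (isCompact_Icc.prod isCompact_Icc).exists_isMaxOn ⟨p, hp⟩
      ((hu.continuousOn.sup hv.continuousOn).sub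
        (by fun_prop : ContinuousOn (fun p : ℝ × ℝ => η * p.1) Q))
    replace hzmax : ∀ q ∈ Q, max (u q.1 q.2) (v q.1 q.2) - η * q.1
        ≤ max (u z.1 z.2) (v z.1 z.2) - η * z.1 := fun q hq => hzmax hq
    have hpos' : 0 < η * ε ^ 2 := by positivity
    have hzM : max (u z.1 z.2) (v z.1 z.2) ≤ M := by
      rcases le_total (v z.1 z.2) (u z.1 z.2) with hvu | huv
      · rw [max_eq_left hvu] at hzmax ⊢
        by_contra! hlt
        have ht : 0 < z.1 := hz.1.1.lt_of_ne fun h0 => by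
          rw [← h0, (hinit _ hz.2).1] at hlt
          exact (hin _ hz.2).1.not_gt hlt
        have hx : 0 < z.2 := hz.2.1.lt_of_ne fun h0 => by
          rw [← h0] at hlt
          exact (hu0 _ hz.1).not_gt hlt
        have := mul_fst_le_of_maximal_of_fderiv_eq (d := (ε ^ 2, ε))
          (δ := min (z.1 / ε ^ 2) (z.2 / ε)) (η := η)
          (R := fun p => (u p.1 p.2 + v p.1 p.2) ^ α * (v p.1 p.2 - u p.1 p.2))
          (by positivity) hz (fun s hs => by
            obtain ⟨hs0, hs1⟩ := hs
            obtain ⟨h1, h2⟩ := lt_min_iff.1 hs1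
            rw [lt_div_iff₀ (by positivity)] at h1 h2
            have h3 : 0 < s * ε ^ 2 := by positivity
            have h4 : 0 < s * ε := by positivity
            rw [hQint]
            simp only [Set.mem_prod, Set.mem_Ioo, Prod.fst_sub, Prod.snd_sub, Prod.smul_fst,
              Prod.smul_snd, smul_eq_mul]
            exact ⟨⟨by linarith, by linarith [hz.1.2]⟩, by linarith, by linarith [hz.2.2]⟩)
          hu ((hρ.mul (hv.continuousOn.sub hu.continuousOn)) z hz)
          (fun q hq => by
            rw [fderiv_uncurry_apply _ _ ((hu.contDiffAt
              (mem_interior_iff_mem_nhds.1 hq)).differentiableAt (by norm_num))]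
            rw [hQint] at hq
            exact (heq _ hq.1 _ hq.2).1)
          (fun q hq => (sub_le_sub_right (le_max_left _ _) _).trans (hzmax q hq))
        have h' := mul_nonneg (hρ0 z hz) (sub_nonneg.2 hvu)
        simp only at this
        linarith
      · rw [max_eq_right huv] at hzmax ⊢
        by_contra! hlt
        have ht : 0 < z.1 := hz.1.1.lt_of_ne fun h0 => by
          rw [← h0, (hinit _ hz.2).2] at hlt
          exact (hin _ hz.2).2.not_gt hlt
        have hx : 0 < 1 - z.2 := sub_pos.2 <| hz.2.2.lt_of_ne fun h0 => by
          rw [h0] at hlt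
          exact (hv1 _ hz.1).not_gt hlt
        have := mul_fst_le_of_maximal_of_fderiv_eq (d := (ε ^ 2, -ε))
          (δ := min (z.1 / ε ^ 2) ((1 - z.2) / ε)) (η := η)
          (R := fun p => (u p.1 p.2 + v p.1 p.2) ^ α * (u p.1 p.2 - v p.1 p.2))
          (by positivity) hz (fun s hs => by
            obtain ⟨hs0, hs1⟩ := hs
            obtain ⟨h1, h2⟩ := lt_min_iff.1 hs1
            rw [lt_div_iff₀ (by positivity)] at h1 h2
            have h3 : 0 < s * ε ^ 2 := by positivity
            have h4 : 0 < s * ε := by positivity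
            rw [hQint]
            simp only [Set.mem_prod, Set.mem_Ioo, Prod.fst_sub, Prod.snd_sub, Prod.smul_fst,
              Prod.smul_snd, smul_eq_mul, mul_neg]
            exact ⟨⟨by linarith, by linarith [hz.1.2]⟩, by linarith [hz.2.1], by linarith⟩)
          hv ((hρ.mul (hu.continuousOn.sub hv.continuousOn)) z hz)
          (fun q hq => by
            rw [fderiv_uncurry_apply _ _ ((hv.contDiffAt
              (mem_interior_iff_mem_nhds.1 hq)).differentiableAt (by norm_num)),
              neg_mul, ← sub_eq_add_neg]
            rw [hQint] at hq
            exact (heq _ hq.1 _ hq.2).2)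
          (fun q hq => (sub_le_sub_right (le_max_right _ _) _).trans (hzmax q hq))
        have h' := mul_nonneg (hρ0 z hz) (sub_nonneg.2 huv)
        simp only at this
        linarith
    have h1 := hzmax p hp
    have h2 := mul_le_mul_of_nonneg_left hp.1.2 hη.le
    have h3 := mul_nonneg hη.le hz.1.1
    linarith
  intro t ht x hx
  refine max_le_iff.1 (le_of_forall_pos_le_add fun η hη => ?_)
  simpa [div_mul_cancel₀ η hT.ne'] using key (η / T) (by positivity) (t, x) ⟨ht, hx⟩

/-- Admissible data have a common positive upper bound. -/
theorem AdmissibleData.exists_bound {T : ℝ} {φm φp uin vin : ℝ → ℝ}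
    (h : AdmissibleData T φm φp uin vin) :
    ∃ M : ℝ, 0 < M ∧ (∀ t ∈ Set.Icc 0 T, φm t ≤ M ∧ φp t ≤ M) ∧
      ∀ x ∈ Set.Icc (0:ℝ) 1, uin x ≤ M ∧ vin x ≤ M := by
  obtain ⟨hφm, hφp, -, huin, hvin, -⟩ := h
  obtain ⟨a, ha⟩ := isCompact_Icc.bddAbove_image (hφm.continuousOn.sup hφp.continuousOn)
  obtain ⟨b, hb⟩ := isCompact_Icc.bddAbove_image (huin.sup hvin)
  refine ⟨max 1 (max a b), by positivity, fun t ht => ?_, fun x hx => ?_⟩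
  · exact max_le_iff.1 ((ha (Set.mem_image_of_mem _ ht)).trans (by simp))
  · exact max_le_iff.1 ((hb (Set.mem_image_of_mem _ hx)).trans (by simp))

/-- Uniform `L²` bound on the macroscopic density: for admissible data there is a constant
`K`, independent of `ε`, such that `∫₀ᵀ∫₀¹ ρ_ε² ≤ K` for every classical solution of the
scaled generalized Carleman system, where `ρ_ε = u_ε + v_ε`. -/
theorem density_uniform_L2_bound
    (α T : ℝ) (hα : α ∈ Set.Icc (-1:ℝ) 1) (hT : 0 < T)
    (φm φp uin vin : ℝ → ℝ) (hdata : AdmissibleData T φm φp uin vin) :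
    ∃ K : ℝ, 0 < K ∧ ∀ ε : ℝ, 0 < ε → ∀ u v : ℝ → ℝ → ℝ,
      IsScaledCarlemanSol α T ε φm φp uin vin u v →
      (∫ t in (0:ℝ)..T, ∫ x in (0:ℝ)..1, (u t x + v t x) ^ 2) ≤ K := by
  obtain ⟨M, hM, hφ, hin⟩ := hdata.exists_bound
  refine ⟨(2 * M) ^ 2 * T, by positivity, fun ε hε u v h => ?_⟩
  have hle := h.le_of_data_le hT hε hφ hin
  obtain ⟨-, -, hpos, -⟩ := h
  have hinner : ∀ t ∈ Set.uIoc 0 T,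
      ‖∫ x in (0:ℝ)..1, (u t x + v t x) ^ 2‖ ≤ (2 * M) ^ 2 := by
    intro t ht
    rw [Set.uIoc_of_le hT.le] at ht
    have ht' := Set.Ioc_subset_Icc_self ht
    refine (intervalIntegral.norm_integral_le_of_norm_le_const (C := (2 * M) ^ 2)
      fun x hx => ?_).trans (by simp)
    rw [Set.uIoc_of_le zero_le_one] at hx
    have hx' := Set.Ioc_subset_Icc_self hx
    obtain ⟨h1, h2⟩ := hle t ht' x hx'
    rw [Real.norm_of_nonneg (sq_nonneg _)]
    exact pow_le_pow_left₀ (hpos t ht' x hx').2.2.le (by linarith) 2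
  have h := intervalIntegral.norm_integral_le_of_norm_le_const hinner
  rw [sub_zero, abs_of_pos hT] at h
  exact (Real.le_norm_self _).trans h
end

section
/- Fix α ∈ [0,1], T > 0 and admissible data (u_in, v_in, φ⁻, φ⁺). Then there exists a constant L > 0, depending only on α, T, φ⁻, φ⁺, u_in, v_in (and not on ε), such that for every ε > 0 and every classical solution (u_ε, v_ε) on [0,T] of the scaled generalized Carleman system with these data, setting ρ_ε = u_ε + v_ε and j_ε = (u_ε − v_ε)/ε, one has both ∫₀ᵀ ∫₀¹ ρ_ε^{α+1} j_ε² dx dt ≤ L and ∫₀ᵀ ∫₀¹ ρ_ε^{α−1} j_ε² dx dt ≤ L. -/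
open MeasureTheory Set intervalIntegral

section

open Real

/-- Bregman divergence of `s ↦ s³/3 + (s+δ) log (s+δ)`, the regularised entropy whose production
controls both weighted fluxes. -/
noncomputable def regRelEntropy (δ s a : ℝ) : ℝ :=
  (s - a) ^ 2 * (s + 2 * a) / 3 + ((s + δ) * (log (s + δ) - log (a + δ)) - (s - a))

lemma mul_log_sub_log_ge {p q : ℝ} (hp : 0 < p) (hq : 0 < q) :
    p - q ≤ p * (log p - log q) := by
  have h := log_le_sub_one_of_pos (div_pos hq hp)
  rw [log_div hq.ne' hp.ne'] at h
  have h2 : p * (log q - log p) ≤ p * (q / p - 1) := mul_le_mul_of_nonneg_left h hp.le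
  have h3 : p * (q / p - 1) = q - p := by field_simp
  linarith

lemma mul_log_sub_log_le {p q : ℝ} (hp : 0 < p) (hq : 0 < q) :
    p * (log p - log q) ≤ (p - q) + (p - q) ^ 2 / q := by
  have h := log_le_sub_one_of_pos (div_pos hp hq)
  rw [log_div hp.ne' hq.ne'] at h
  have h2 : p * (log p - log q) ≤ p * (p / q - 1) := mul_le_mul_of_nonneg_left h hp.le
  have h3 : p * (p / q - 1) = (p - q) + (p - q) ^ 2 / q := by field_simp; ring
  linarith

lemma sq_div_add_le_sub_mul_log_sub_log {p q : ℝ} (hp : 0 < p) (hq : 0 < q) :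
    (p - q) ^ 2 / (p + q) ≤ (p - q) * (log p - log q) := by
  wlog hpq : q ≤ p generalizing p q
  · have := this hq hp (le_of_not_ge hpq)
    rw [add_comm q p] at this
    linear_combination this
  have h := mul_log_sub_log_ge hp hq
  have h1 : (p - q) / p ≤ log p - log q := by rw [div_le_iff₀ hp]; linarith
  calc (p - q) ^ 2 / (p + q) ≤ (p - q) ^ 2 / p := by gcongr; linarith
    _ = (p - q) * ((p - q) / p) := by ring
    _ ≤ _ := mul_le_mul_of_nonneg_left h1 (by linarith)

lemma cubic_le_regRelEntropy {δ s a : ℝ} (hδ : 0 < δ) (hs : 0 ≤ s) (ha : 0 < a) :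
    (s - a) ^ 2 * (s + 2 * a) / 3 ≤ regRelEntropy δ s a := by
  have := mul_log_sub_log_ge (show 0 < s + δ by linarith) (show 0 < a + δ by linarith)
  unfold regRelEntropy
  linarith

lemma regRelEntropy_nonneg {δ s a : ℝ} (hδ : 0 < δ) (hs : 0 ≤ s) (ha : 0 < a) :
    0 ≤ regRelEntropy δ s a :=
  le_trans (by positivity) (cubic_le_regRelEntropy hδ hs ha)

lemma regRelEntropy_self (δ a : ℝ) : regRelEntropy δ a a = 0 := by
  simp [regRelEntropy]

lemma abs_sub_le_regRelEntropy {δ s a m : ℝ} (hδ : 0 < δ) (hs : 0 ≤ s) (hm : 0 < m)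
    (ha : m ≤ a) : |s - a| ≤ 1 + 3 / (2 * m) * regRelEntropy δ s a := by
  have h := cubic_le_regRelEntropy hδ hs (hm.trans_le ha)
  have h1 : 2 * m / 3 * (s - a) ^ 2 ≤ regRelEntropy δ s a := by
    nlinarith [sq_nonneg (s - a)]
  have h2 : (s - a) ^ 2 ≤ 3 / (2 * m) * regRelEntropy δ s a := by
    calc (s - a) ^ 2 = 3 / (2 * m) * (2 * m / 3 * (s - a) ^ 2) := by field_simp
      _ ≤ _ := by gcongr
  nlinarith [sq_abs (s - a), sq_nonneg (|s - a| - 1)]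

lemma regRelEntropy_le {δ s a m U A : ℝ} (hδ : 0 < δ) (hs : 0 ≤ s) (hm : 0 < m)
    (ha : m ≤ a) (hsU : s ≤ U) (haA : a ≤ A) :
    regRelEntropy δ s a ≤ (U + A) ^ 2 * (U + 2 * A) / 3 + (U + A) ^ 2 / m := by
  have h := mul_log_sub_log_le (show 0 < s + δ by linarith) (show 0 < a + δ by linarith)
  have h0 : (s - a) ^ 2 ≤ (U + A) ^ 2 := by
    apply sq_le_sq'
    all_goals linarith
  have h1 : (s + δ - (a + δ)) ^ 2 / (a + δ) ≤ (U + A) ^ 2 / m := by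
    rw [show s + δ - (a + δ) = s - a by ring]
    gcongr
    linarith
  have h2 : (s - a) ^ 2 * (s + 2 * a) / 3 ≤ (U + A) ^ 2 * (U + 2 * A) / 3 := by
    have : 0 < a := by linarith
    gcongr
  unfold regRelEntropy
  linarith

lemma hasDerivAt_regRelEntropy {δ s' a' t : ℝ} {s a : ℝ → ℝ}
    (hs : HasDerivAt s s' t) (ha : HasDerivAt a a' t) (hsδ : s t + δ ≠ 0) (haδ : a t + δ ≠ 0) :
    HasDerivAt (fun r => regRelEntropy δ (s r) (a r))
      ((s t ^ 2 - a t ^ 2 + log (s t + δ) - log (a t + δ)) * s'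
        - (2 * a t + 1 / (a t + δ)) * (s t - a t) * a') t := by
  have h := ((((hs.sub ha).pow 2).mul (hs.add (ha.const_mul 2))).div_const 3).add
    (((hs.add_const δ).mul (((hs.add_const δ).log hsδ).sub ((ha.add_const δ).log haδ))).sub
      (hs.sub ha))
  refine h.congr_deriv ?_
  simp only [Pi.sub_apply, Pi.pow_apply, Pi.add_apply]
  field_simp
  ring

lemma differentiableAt_regRelEntropy {E : Type*} [NormedAddCommGroup E] [NormedSpace ℝ E]
    {δ : ℝ} {s a : E → ℝ} {p : E} (hs : DifferentiableAt ℝ s p) (ha : DifferentiableAt ℝ a p)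
    (hsδ : s p + δ ≠ 0) (haδ : a p + δ ≠ 0) :
    DifferentiableAt ℝ (fun q => regRelEntropy δ (s q) (a q)) p := by
  unfold regRelEntropy
  fun_prop (disch := assumption)

lemma continuousOn_regRelEntropy {X : Type*} [TopologicalSpace X]
    {δ : ℝ} {s a : X → ℝ} {K : Set X} (hs : ContinuousOn s K) (ha : ContinuousOn a K)
    (hsδ : ∀ p ∈ K, s p + δ ≠ 0) (haδ : ∀ p ∈ K, a p + δ ≠ 0) :
    ContinuousOn (fun q => regRelEntropy δ (s q) (a q)) K := by
  unfold regRelEntropy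
  fun_prop (disch := assumption)

lemma one_le_rpow_add_one_add_rpow_sub_one {α ρ : ℝ} (hα : α ∈ Icc (0 : ℝ) 1) (hρ : 0 < ρ) :
    1 ≤ ρ ^ (α + 1) + ρ ^ (α - 1) := by
  rcases le_total 1 ρ with h | h
  · have := one_le_rpow h (show 0 ≤ α + 1 by linarith [hα.1])
    have := rpow_nonneg hρ.le (α - 1)
    linarith
  · have := one_le_rpow_of_pos_of_le_one_of_nonpos hρ h (show α - 1 ≤ 0 by linarith [hα.2])
    have := rpow_nonneg hρ.le (α + 1)
    linarith

/-- The production of the regularised entropy dominates both weighted squared fluxes. -/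
lemma half_flux_le_production {α δ ε u v : ℝ} (hδ : 0 < δ) (hu : 0 ≤ u) (hv : 0 ≤ v)
    (hρδ : 2 * δ ≤ u + v) :
    1 / 2 * (((u + v) ^ (α + 1) + (u + v) ^ (α - 1)) * ((u - v) / ε) ^ 2) ≤
      (u + v) ^ α * (u - v) * (u ^ 2 - v ^ 2 + log (u + δ) - log (v + δ)) / ε ^ 2 := by
  have hρ : 0 < u + v := by linarith
  have h := sq_div_add_le_sub_mul_log_sub_log (show 0 < u + δ by linarith)
    (show 0 < v + δ by linarith)
  have h1 : (u - v) ^ 2 / (2 * (u + v)) ≤ (u - v) * (log (u + δ) - log (v + δ)) := by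
    calc (u - v) ^ 2 / (2 * (u + v)) ≤ (u - v) ^ 2 / (u + δ + (v + δ)) := by
          gcongr; linarith
      _ ≤ _ := by simpa using h
  have hα : 0 < (u + v) ^ α := rpow_pos_of_pos hρ α
  rw [rpow_add_one hρ.ne', rpow_sub_one hρ.ne']
  calc 1 / 2 * (((u + v) ^ α * (u + v) + (u + v) ^ α / (u + v)) * ((u - v) / ε) ^ 2)
      = (u + v) ^ α * (1 / 2 * ((u + v) * (u - v) ^ 2) + (u - v) ^ 2 / (2 * (u + v))) / ε ^ 2 := by
        field_simp
    _ ≤ (u + v) ^ α * ((u + v) * (u - v) ^ 2 + (u - v) * (log (u + δ) - log (v + δ))) / ε ^ 2 := by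
        have : 0 ≤ (u + v) * (u - v) ^ 2 := by positivity
        exact div_le_div_of_nonneg_right
          (mul_le_mul_of_nonneg_left (add_le_add (by linarith) h1) hα.le) (by positivity)
    _ = _ := by ring

/-- Pointwise dissipation estimate for the exponentially weighted relative entropy. -/
lemma weighted_dissipation_le {α δ ε u v a a₁ a₂ m M N t T : ℝ} (hα : α ∈ Icc (0 : ℝ) 1)
    (ht : t ∈ Icc 0 T) (hδ : 0 < δ) (hu : 0 ≤ u) (hv : 0 ≤ v) (hρδ : 2 * δ ≤ u + v)
    (hm : 0 < m) (ha : m ≤ a)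
    (h₁ : |(2 * a + 1 / (a + δ)) * a₁| ≤ M) (h₂ : |(2 * a + 1 / (a + δ)) * a₂| ≤ N) :
    exp (-(3 * M / (2 * m)) * t) *
        (-(3 * M / (2 * m)) * (regRelEntropy δ u a + regRelEntropy δ v a)
          - (u + v) ^ α * (u - v) * (u ^ 2 - v ^ 2 + log (u + δ) - log (v + δ)) / ε ^ 2
          - (2 * a + 1 / (a + δ)) * a₁ * (u + v - 2 * a)
          - (2 * a + 1 / (a + δ)) * a₂ * ((u - v) / ε)) ≤
      -(1 / 4 * exp (-(3 * M / (2 * m)) * T)) *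
          (((u + v) ^ (α + 1) + (u + v) ^ (α - 1)) * ((u - v) / ε) ^ 2) + (N ^ 2 + 2 * M) := by
  have hρ : 0 < u + v := by linarith
  have hM : 0 ≤ M := (abs_nonneg _).trans h₁
  have hprod := half_flux_le_production (α := α) (ε := ε) hδ hu hv hρδ
  have hone := one_le_rpow_add_one_add_rpow_sub_one hα hρ
  set j := (u - v) / ε
  set S := ((u + v) ^ (α + 1) + (u + v) ^ (α - 1)) * j ^ 2
  have hjS : j ^ 2 ≤ S := le_mul_of_one_le_left (sq_nonneg j) hone
  set g₁ := (2 * a + 1 / (a + δ)) * a₁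
  set g₂ := (2 * a + 1 / (a + δ)) * a₂
  have herr₂ : -(g₂ * j) ≤ 1 / 4 * j ^ 2 + N ^ 2 := by
    have : g₂ ^ 2 ≤ N ^ 2 := sq_le_sq' (abs_le.1 h₂).1 (abs_le.1 h₂).2
    nlinarith [sq_nonneg (1 / 2 * j + g₂)]
  have hu' := abs_sub_le_regRelEntropy hδ hu hm ha
  have hv' := abs_sub_le_regRelEntropy hδ hv hm ha
  have herr₁ : -(g₁ * (u + v - 2 * a)) ≤
      2 * M + 3 * M / (2 * m) * (regRelEntropy δ u a + regRelEntropy δ v a) := by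
    calc -(g₁ * (u + v - 2 * a)) ≤ |g₁ * (u + v - 2 * a)| := neg_le_abs _
      _ = |g₁| * |(u - a) + (v - a)| := by rw [abs_mul]; ring_nf
      _ ≤ M * (|u - a| + |v - a|) := by gcongr; exact abs_add_le _ _
      _ ≤ M * ((1 + 3 / (2 * m) * regRelEntropy δ u a) +
            (1 + 3 / (2 * m) * regRelEntropy δ v a)) := by gcongr
      _ = _ := by ring
  have hS0 : 0 ≤ S := (sq_nonneg j).trans hjS
  have hE1 : exp (-(3 * M / (2 * m)) * t) ≤ 1 := by
    rw [exp_le_one_iff]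
    have : 0 ≤ 3 * M / (2 * m) * t := mul_nonneg (by positivity) ht.1
    linarith
  have hE2 : exp (-(3 * M / (2 * m)) * T) ≤ exp (-(3 * M / (2 * m)) * t) := by
    rw [exp_le_exp]
    have : 3 * M / (2 * m) * t ≤ 3 * M / (2 * m) * T :=
      mul_le_mul_of_nonneg_left ht.2 (by positivity)
    linarith
  calc _ ≤ exp (-(3 * M / (2 * m)) * t) * (-(1 / 4 * S) + (N ^ 2 + 2 * M)) := by
        gcongr
        linarith
    _ ≤ _ := by
        nlinarith [mul_le_mul_of_nonneg_right hE2 hS0,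
          mul_le_mul_of_nonneg_right hE1 (show 0 ≤ N ^ 2 + 2 * M by positivity)]

lemma intervalIntegral_eq_setIntegral_prod {T : ℝ} (hT : 0 ≤ T) {F : ℝ × ℝ → ℝ}
    (hF : ContinuousOn F (Icc 0 T ×ˢ Icc (0 : ℝ) 1)) :
    (∫ t in (0 : ℝ)..T, ∫ x in (0 : ℝ)..1, F (t, x)) = ∫ p in Icc 0 T ×ˢ Icc (0 : ℝ) 1, F p := by
  rw [Measure.volume_eq_prod, setIntegral_prod _
    (hF.integrableOn_compact (isCompact_Icc.prod isCompact_Icc)), integral_of_le hT,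
    integral_Icc_eq_integral_Ioc]
  simp_rw [integral_of_le zero_le_one, integral_Icc_eq_integral_Ioc]

/-- Divergence theorem on `[0,T] × [0,1]` in terms of the two partial derivatives. -/
lemma setIntegral_divergence_prod {T : ℝ} (hT : 0 ≤ T) {f g D ft gx : ℝ × ℝ → ℝ}
    (hf : ContinuousOn f (Icc 0 T ×ˢ Icc (0 : ℝ) 1))
    (hg : ContinuousOn g (Icc 0 T ×ˢ Icc (0 : ℝ) 1))
    (hD : ContinuousOn D (Icc 0 T ×ˢ Icc (0 : ℝ) 1))
    (hfd : ∀ p ∈ Ioo 0 T ×ˢ Ioo (0 : ℝ) 1, DifferentiableAt ℝ f p)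
    (hgd : ∀ p ∈ Ioo 0 T ×ˢ Ioo (0 : ℝ) 1, DifferentiableAt ℝ g p)
    (hft : ∀ p ∈ Ioo 0 T ×ˢ Ioo (0 : ℝ) 1, HasDerivAt (fun s => f (s, p.2)) (ft p) p.1)
    (hgx : ∀ p ∈ Ioo 0 T ×ˢ Ioo (0 : ℝ) 1, HasDerivAt (fun y => g (p.1, y)) (gx p) p.2)
    (hsum : ∀ p ∈ Ioo 0 T ×ˢ Ioo (0 : ℝ) 1, ft p + gx p = D p) :
    ∫ p in Icc 0 T ×ˢ Icc (0 : ℝ) 1, D p =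
      (((∫ t in (0 : ℝ)..T, g (t, 1)) - ∫ t in (0 : ℝ)..T, g (t, 0)) +
        ∫ y in (0 : ℝ)..1, f (T, y)) - ∫ y in (0 : ℝ)..1, f (0, y) := by
  classical
  have hf' : ∀ p ∈ Ioo 0 T ×ˢ Ioo (0 : ℝ) 1, fderiv ℝ f p (1, 0) = ft p := fun p hp =>
    (((hfd p hp).hasFDerivAt.comp_hasDerivAt p.1
      ((hasDerivAt_id p.1).prodMk (hasDerivAt_const p.1 p.2)))).unique (hft p hp)
  have hg' : ∀ p ∈ Ioo 0 T ×ˢ Ioo (0 : ℝ) 1, fderiv ℝ g p (0, 1) = gx p := fun p hp =>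
    (((hgd p hp).hasFDerivAt.comp_hasDerivAt p.2
      ((hasDerivAt_const p.2 p.1).prodMk (hasDerivAt_id p.2)))).unique (hgx p hp)
  -- the values of the derivative of `f` off the open rectangle are chosen so that the divergence
  -- is `D` everywhere
  let f' : ℝ × ℝ → ℝ × ℝ →L[ℝ] ℝ := fun p =>
    if p ∈ Ioo 0 T ×ˢ Ioo (0 : ℝ) 1 then fderiv ℝ f p
    else D p • ContinuousLinearMap.fst ℝ ℝ ℝ - fderiv ℝ g p (0, 1) • ContinuousLinearMap.fst ℝ ℝ ℝ
  have hdiv : ∀ p, f' p (1, 0) + fderiv ℝ g p (0, 1) = D p := by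
    intro p
    by_cases hp : p ∈ Ioo 0 T ×ˢ Ioo (0 : ℝ) 1
    · simp only [f', if_pos hp, hf' p hp, hg' p hp, hsum p hp]
    · simp only [f', if_neg hp]
      simp
  have hI : Icc ((0, 0) : ℝ × ℝ) (T, 1) = Icc 0 T ×ˢ Icc (0 : ℝ) 1 := Icc_prod_eq _ _
  have := integral_divergence_prod_Icc_of_hasFDerivAt_off_countable_of_le f g f' (fderiv ℝ g)
    (0, 0) (T, 1) ⟨hT, zero_le_one⟩ ∅ countable_empty (hI ▸ hf) (hI ▸ hg)
    (fun p hp => by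
      simp only [f', if_pos hp.1]
      exact (hfd p hp.1).hasFDerivAt)
    (fun p hp => (hgd p hp.1).hasFDerivAt)
    (by
      simp only [hdiv, hI]
      exact hD.integrableOn_compact (isCompact_Icc.prod isCompact_Icc))
  simpa only [hdiv, hI] using this

/-- Integrated form of a differential entropy inequality `∂ₜ f + ∂ₓ g = D ≤ -c S + k`. -/
lemma mul_setIntegral_le_of_divergence_le {T c k I : ℝ} (hT : 0 ≤ T)
    {f g D ft gx S : ℝ × ℝ → ℝ}
    (hf : ContinuousOn f (Icc 0 T ×ˢ Icc (0 : ℝ) 1))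
    (hg : ContinuousOn g (Icc 0 T ×ˢ Icc (0 : ℝ) 1))
    (hD : ContinuousOn D (Icc 0 T ×ˢ Icc (0 : ℝ) 1))
    (hS : ContinuousOn S (Icc 0 T ×ˢ Icc (0 : ℝ) 1))
    (hfd : ∀ p ∈ Ioo 0 T ×ˢ Ioo (0 : ℝ) 1, DifferentiableAt ℝ f p)
    (hgd : ∀ p ∈ Ioo 0 T ×ˢ Ioo (0 : ℝ) 1, DifferentiableAt ℝ g p)
    (hft : ∀ p ∈ Ioo 0 T ×ˢ Ioo (0 : ℝ) 1, HasDerivAt (fun s => f (s, p.2)) (ft p) p.1)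
    (hgx : ∀ p ∈ Ioo 0 T ×ˢ Ioo (0 : ℝ) 1, HasDerivAt (fun y => g (p.1, y)) (gx p) p.2)
    (hsum : ∀ p ∈ Ioo 0 T ×ˢ Ioo (0 : ℝ) 1, ft p + gx p = D p)
    (hDS : ∀ p ∈ Icc 0 T ×ˢ Icc (0 : ℝ) 1, D p ≤ -c * S p + k)
    (hg0 : ∀ t ∈ Ioo 0 T, g (t, 0) ≤ 0) (hg1 : ∀ t ∈ Ioo 0 T, 0 ≤ g (t, 1))
    (hfT : ∀ y ∈ Icc (0 : ℝ) 1, 0 ≤ f (T, y)) (hf0 : ∀ y ∈ Icc (0 : ℝ) 1, f (0, y) ≤ I) :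
    c * ∫ p in Icc 0 T ×ˢ Icc (0 : ℝ) 1, S p ≤ k * T + I := by
  have hK : IsCompact (Icc 0 T ×ˢ Icc (0 : ℝ) 1) := isCompact_Icc.prod isCompact_Icc
  have hdiv := setIntegral_divergence_prod hT hf hg hD hfd hgd hft hgx hsum
  have hmono : ∫ p in Icc 0 T ×ˢ Icc (0 : ℝ) 1, D p ≤
      ∫ p in Icc 0 T ×ˢ Icc (0 : ℝ) 1, (-c * S p + k) :=
    setIntegral_mono_on (hD.integrableOn_compact hK)
      ((hS.const_mul _ |>.add continuousOn_const).integrableOn_compact hK)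
      (measurableSet_Icc.prod measurableSet_Icc) hDS
  have hvol : (volume : Measure (ℝ × ℝ)).real (Icc 0 T ×ˢ Icc (0 : ℝ) 1) = T := by
    rw [Measure.volume_eq_prod, measureReal_prod_prod]
    simp [hT]
  have hrhs : ∫ p in Icc 0 T ×ˢ Icc (0 : ℝ) 1, (-c * S p + k) =
      -c * (∫ p in Icc 0 T ×ˢ Icc (0 : ℝ) 1, S p) + k * T := by
    rw [integral_add ((hS.integrableOn_compact hK).const_mul _)
      (continuousOn_const.integrableOn_compact hK), MeasureTheory.integral_const_mul, setIntegral_const, hvol,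
      smul_eq_mul, mul_comm T]
  have hslice : ∀ y ∈ Icc (0 : ℝ) 1, ContinuousOn (fun t => g (t, y)) (uIcc 0 T) := fun y hy =>
    hg.comp (by fun_prop) fun t ht => ⟨by rwa [uIcc_of_le hT] at ht, hy⟩
  have hfslice : ContinuousOn (fun y => f (0, y)) (uIcc 0 1) :=
    hf.comp (by fun_prop) fun y hy => ⟨left_mem_Icc.2 hT, by rwa [uIcc_of_le zero_le_one] at hy⟩
  have h1 : 0 ≤ ∫ t in (0 : ℝ)..T, g (t, 1) := by
    simpa using integral_mono_on_of_le_Ioo hT (intervalIntegrable_const (c := (0 : ℝ)))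
      (hslice 1 (by simp)).intervalIntegrable hg1
  have h0 : ∫ t in (0 : ℝ)..T, g (t, 0) ≤ 0 := by
    simpa using integral_mono_on_of_le_Ioo hT (hslice 0 (by simp)).intervalIntegrable
      (intervalIntegrable_const (c := (0 : ℝ))) hg0
  have hTint : 0 ≤ ∫ y in (0 : ℝ)..1, f (T, y) := integral_nonneg zero_le_one hfT
  have h0int : ∫ y in (0 : ℝ)..1, f (0, y) ≤ I := by
    simpa using integral_mono_on (μ := volume) zero_le_one hfslice.intervalIntegrable
      (intervalIntegrable_const (c := I)) hf0
  linarith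

lemma hasDerivAt_sections {w : ℝ → ℝ → ℝ} {p : ℝ × ℝ}
    (hw : DifferentiableAt ℝ (fun q : ℝ × ℝ => w q.1 q.2) p) :
    HasDerivAt (fun s => w s p.2) (deriv (fun s => w s p.2) p.1) p.1 ∧
      HasDerivAt (fun y => w p.1 y) (deriv (fun y => w p.1 y) p.2) p.2 := by
  constructor
  · exact (hw.hasFDerivAt.comp_hasDerivAt p.1
      ((hasDerivAt_id p.1).prodMk (hasDerivAt_const p.1 p.2))).differentiableAt.hasDerivAt
  · exact (hw.hasFDerivAt.comp_hasDerivAt p.2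
      ((hasDerivAt_const p.2 p.1).prodMk (hasDerivAt_id p.2))).differentiableAt.hasDerivAt

lemma rectangle_mem_nhds {T : ℝ} {p : ℝ × ℝ} (hp : p ∈ Ioo 0 T ×ˢ Ioo (0 : ℝ) 1) :
    Icc 0 T ×ˢ Icc (0 : ℝ) 1 ∈ nhds p :=
  prod_mem_nhds (Icc_mem_nhds hp.1.1 hp.1.2) (Icc_mem_nhds hp.2.1 hp.2.2)

/-- Entropy estimate for one solution, relative to the linear interpolation of the boundary data. -/
lemma IsScaledCarlemanSol.mul_setIntegral_flux_le {α T ε m A B U M N δ : ℝ}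
    {φm φp uin vin : ℝ → ℝ} {u v : ℝ → ℝ → ℝ} (hα : α ∈ Icc (0 : ℝ) 1) (hT : 0 < T) (hε : 0 < ε)
    (hm : 0 < m) (hdata : AdmissibleData T φm φp uin vin)
    (hφm : ∀ t ∈ Icc 0 T, m ≤ φm t ∧ φm t ≤ A ∧ |derivWithin φm (Icc 0 T) t| ≤ B)
    (hφp : ∀ t ∈ Icc 0 T, m ≤ φp t ∧ φp t ≤ A ∧ |derivWithin φp (Icc 0 T) t| ≤ B)
    (hin : ∀ x ∈ Icc (0 : ℝ) 1, uin x ≤ U ∧ vin x ≤ U)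
    (hM : (2 * A + 1 / m) * B ≤ M) (hN : (2 * A + 1 / m) * A ≤ N)
    (hsol : IsScaledCarlemanSol α T ε φm φp uin vin u v) (hδ : 0 < δ)
    (hρδ : ∀ p ∈ Icc 0 T ×ˢ Icc (0 : ℝ) 1, 2 * δ ≤ u p.1 p.2 + v p.1 p.2) :
    1 / 4 * exp (-(3 * M / (2 * m)) * T) * ∫ p in Icc 0 T ×ˢ Icc (0 : ℝ) 1,
        ((u p.1 p.2 + v p.1 p.2) ^ (α + 1) + (u p.1 p.2 + v p.1 p.2) ^ (α - 1)) *
          ((u p.1 p.2 - v p.1 p.2) / ε) ^ 2 ≤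
      (N ^ 2 + 2 * M) * T + 2 * ((U + A) ^ 2 * (U + 2 * A) / 3 + (U + A) ^ 2 / m) := by
  obtain ⟨hφmC, hφpC, -, -, -, -⟩ := hdata
  obtain ⟨huC, hvC, hpos, hpde, hbc, hic⟩ := hsol
  set K := Icc 0 T ×ˢ Icc (0 : ℝ) 1
  set C := 3 * M / (2 * m)
  let a : ℝ × ℝ → ℝ := fun p => (1 - p.2) * φm p.1 + p.2 * φp p.1
  let aₜ : ℝ × ℝ → ℝ := fun p =>
    (1 - p.2) * derivWithin φm (Icc 0 T) p.1 + p.2 * derivWithin φp (Icc 0 T) p.1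
  let aₓ : ℝ × ℝ → ℝ := fun p => φp p.1 - φm p.1
  let u' : ℝ × ℝ → ℝ := fun p => u p.1 p.2
  let v' : ℝ × ℝ → ℝ := fun p => v p.1 p.2
  have hu0 : ∀ p ∈ K, 0 ≤ u' p := fun p hp => (hpos p.1 hp.1 p.2 hp.2).1
  have hv0 : ∀ p ∈ K, 0 ≤ v' p := fun p hp => (hpos p.1 hp.1 p.2 hp.2).2.1
  have hρ0 : ∀ p ∈ K, u' p + v' p ≠ 0 := fun p hp => (hpos p.1 hp.1 p.2 hp.2).2.2.ne'
  have ham : ∀ p ∈ K, m ≤ a p := fun p hp => by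
    nlinarith [mul_le_mul_of_nonneg_left (hφm p.1 hp.1).1 (sub_nonneg.2 hp.2.2),
      mul_le_mul_of_nonneg_left (hφp p.1 hp.1).1 hp.2.1]
  have haA : ∀ p ∈ K, a p ≤ A := fun p hp => by
    nlinarith [mul_le_mul_of_nonneg_left (hφm p.1 hp.1).2.1 (sub_nonneg.2 hp.2.2),
      mul_le_mul_of_nonneg_left (hφp p.1 hp.1).2.1 hp.2.1]
  have hatB : ∀ p ∈ K, |aₜ p| ≤ B := fun p hp => by
    have h1 := abs_le.1 (hφm p.1 hp.1).2.2
    have h2 := abs_le.1 (hφp p.1 hp.1).2.2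
    have h3 := sub_nonneg.2 hp.2.2
    have h4 := hp.2.1
    refine abs_le.2 ⟨?_, ?_⟩
    · nlinarith [mul_le_mul_of_nonneg_left h1.1 h3, mul_le_mul_of_nonneg_left h2.1 h4]
    · nlinarith [mul_le_mul_of_nonneg_left h1.2 h3, mul_le_mul_of_nonneg_left h2.2 h4]
  have haxA : ∀ p ∈ K, |aₓ p| ≤ A := fun p hp => by
    have h1 := hφm p.1 hp.1
    have h2 := hφp p.1 hp.1
    exact abs_le.2 ⟨by simp only [aₓ]; linarith, by simp only [aₓ]; linarith⟩
  have hcoef : ∀ p ∈ K, 0 ≤ 2 * a p + 1 / (a p + δ) ∧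
      2 * a p + 1 / (a p + δ) ≤ 2 * A + 1 / m := fun p hp => by
    have h1 := ham p hp
    have h2 := haA p hp
    have h3 : 0 < a p := hm.trans_le h1
    refine ⟨by positivity, ?_⟩
    gcongr
    linarith
  have haδ : ∀ p ∈ K, a p + δ ≠ 0 := fun p hp => by
    have := ham p hp
    exact ne_of_gt (by linarith)
  have huδ : ∀ p ∈ K, u' p + δ ≠ 0 := fun p hp => ne_of_gt (by linarith [hu0 p hp])
  have hvδ : ∀ p ∈ K, v' p + δ ≠ 0 := fun p hp => ne_of_gt (by linarith [hv0 p hp])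
  have huc : ContinuousOn u' K := huC.continuousOn
  have hvc : ContinuousOn v' K := hvC.continuousOn
  have hfst : MapsTo (Prod.fst : ℝ × ℝ → ℝ) K (Icc 0 T) := fun p hp => hp.1
  have hφmc : ContinuousOn (fun p : ℝ × ℝ => φm p.1) K :=
    hφmC.continuousOn.comp continuousOn_fst hfst
  have hφpc : ContinuousOn (fun p : ℝ × ℝ => φp p.1) K :=
    hφpC.continuousOn.comp continuousOn_fst hfst
  have hdφmc : ContinuousOn (fun p : ℝ × ℝ => derivWithin φm (Icc 0 T) p.1) K :=
    (hφmC.continuousOn_derivWithin (uniqueDiffOn_Icc hT) le_rfl).comp continuousOn_fst hfst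
  have hdφpc : ContinuousOn (fun p : ℝ × ℝ => derivWithin φp (Icc 0 T) p.1) K :=
    (hφpC.continuousOn_derivWithin (uniqueDiffOn_Icc hT) le_rfl).comp continuousOn_fst hfst
  have hac : ContinuousOn a K :=
    ((continuousOn_const.sub continuousOn_snd).mul hφmc).add (continuousOn_snd.mul hφpc)
  have hatc : ContinuousOn aₜ K :=
    ((continuousOn_const.sub continuousOn_snd).mul hdφmc).add (continuousOn_snd.mul hdφpc)
  have haxc : ContinuousOn aₓ K := hφpc.sub hφmc
  have hRu := continuousOn_regRelEntropy huc hac huδ haδ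
  have hRv := continuousOn_regRelEntropy hvc hac hvδ haδ
  have hρpow : ∀ r : ℝ, ContinuousOn (fun p => (u' p + v' p) ^ r) K := fun r =>
    (huc.add hvc).rpow_const fun p hp => Or.inl (hρ0 p hp)
  have hsub : Ioo 0 T ×ˢ Ioo (0 : ℝ) 1 ⊆ K := prod_mono Ioo_subset_Icc_self Ioo_subset_Icc_self
  have hud : ∀ p ∈ Ioo 0 T ×ˢ Ioo (0 : ℝ) 1, DifferentiableAt ℝ u' p := fun p hp =>
    (huC.contDiffAt (rectangle_mem_nhds hp)).differentiableAt one_ne_zero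
  have hvd : ∀ p ∈ Ioo 0 T ×ˢ Ioo (0 : ℝ) 1, DifferentiableAt ℝ v' p := fun p hp =>
    (hvC.contDiffAt (rectangle_mem_nhds hp)).differentiableAt one_ne_zero
  have hφmd : ∀ t ∈ Ioo 0 T, HasDerivAt φm (derivWithin φm (Icc 0 T) t) t := fun t ht =>
    ((hφmC.differentiableOn one_ne_zero t (Ioo_subset_Icc_self ht)).hasDerivWithinAt).hasDerivAt
      (Icc_mem_nhds ht.1 ht.2)
  have hφpd : ∀ t ∈ Ioo 0 T, HasDerivAt φp (derivWithin φp (Icc 0 T) t) t := fun t ht =>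
    ((hφpC.differentiableOn one_ne_zero t (Ioo_subset_Icc_self ht)).hasDerivWithinAt).hasDerivAt
      (Icc_mem_nhds ht.1 ht.2)
  have had : ∀ p ∈ Ioo 0 T ×ˢ Ioo (0 : ℝ) 1, DifferentiableAt ℝ a p := fun p hp => by
    have h1 : DifferentiableAt ℝ (fun q : ℝ × ℝ => φm q.1) p :=
      (hφmd p.1 hp.1).differentiableAt.comp p differentiableAt_fst
    have h2 : DifferentiableAt ℝ (fun q : ℝ × ℝ => φp q.1) p :=
      (hφpd p.1 hp.1).differentiableAt.comp p differentiableAt_fst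
    exact ((differentiableAt_snd.const_sub 1).mul h1).add (differentiableAt_snd.mul h2)
  have hadt : ∀ p ∈ Ioo 0 T ×ˢ Ioo (0 : ℝ) 1, HasDerivAt (fun s => a (s, p.2)) (aₜ p) p.1 :=
    fun p hp => (((hφmd p.1 hp.1).const_mul (1 - p.2)).add
      ((hφpd p.1 hp.1).const_mul p.2)).congr_deriv rfl
  have hadx : ∀ p ∈ Ioo 0 T ×ˢ Ioo (0 : ℝ) 1, HasDerivAt (fun y => a (p.1, y)) (aₓ p) p.2 :=
    fun p hp => ((((hasDerivAt_id p.2).const_sub 1).mul_const (φm p.1)).add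
      ((hasDerivAt_id p.2).mul_const (φp p.1))).congr_deriv (by simp only [aₓ]; ring)
  let R : (ℝ × ℝ → ℝ) → ℝ × ℝ → ℝ := fun w p => regRelEntropy δ (w p) (a p)
  let E : ℝ × ℝ → ℝ := fun p => exp (-C * p.1)
  have hEpos : ∀ p, 0 < E p := fun p => exp_pos _
  have hEd : ∀ p, HasDerivAt (fun s => E (s, p.2)) (E p * -C) p.1 := fun p => by
    exact ((hasDerivAt_id p.1).const_mul (-C)).exp.congr_deriv (by simp [E])
  let f : ℝ × ℝ → ℝ := fun p => E p * (R u' p + R v' p)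
  let g : ℝ × ℝ → ℝ := fun p => E p * ((R u' p - R v' p) / ε)
  let D : ℝ × ℝ → ℝ := fun p => E p * (-C * (R u' p + R v' p)
    - (u' p + v' p) ^ α * (u' p - v' p) *
        (u' p ^ 2 - v' p ^ 2 + log (u' p + δ) - log (v' p + δ)) / ε ^ 2
    - (2 * a p + 1 / (a p + δ)) * aₜ p * (u' p + v' p - 2 * a p)
    - (2 * a p + 1 / (a p + δ)) * aₓ p * ((u' p - v' p) / ε))
  have hRd : ∀ w : ℝ → ℝ → ℝ, ∀ p ∈ Ioo 0 T ×ˢ Ioo (0 : ℝ) 1,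
      DifferentiableAt ℝ (fun q : ℝ × ℝ => w q.1 q.2) p → w p.1 p.2 + δ ≠ 0 →
      HasDerivAt (fun s => R (fun q => w q.1 q.2) (s, p.2)) _ p.1 ∧
        HasDerivAt (fun y => R (fun q => w q.1 q.2) (p.1, y)) _ p.2 := fun w p hp hw hwδ =>
    ⟨hasDerivAt_regRelEntropy (hasDerivAt_sections hw).1 (hadt p hp) hwδ (haδ p (hsub hp)),
      hasDerivAt_regRelEntropy (hasDerivAt_sections hw).2 (hadx p hp) hwδ (haδ p (hsub hp))⟩
  refine mul_setIntegral_le_of_divergence_le (f := f) (g := g) (D := D) hT.le ?_ ?_ ?_ ?_ ?_ ?_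
    (fun p hp => (hEd p).mul ((hRd u p hp (hud p hp) (huδ p (hsub hp))).1.add
      (hRd v p hp (hvd p hp) (hvδ p (hsub hp))).1))
    (fun p hp => (((hRd u p hp (hud p hp) (huδ p (hsub hp))).2.sub
      (hRd v p hp (hvd p hp) (hvδ p (hsub hp))).2).div_const ε).const_mul (E p))
    ?_ ?_ ?_ ?_ ?_ ?_
  · fun_prop
  · fun_prop (disch := exact fun _ _ => hε.ne')
  · have hlog := ((((huc.pow 2).sub (hvc.pow 2)).add
      ((huc.add continuousOn_const).log huδ)).sub ((hvc.add continuousOn_const).log hvδ))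
    have hk := (hac.const_mul 2).add
      ((continuousOn_const (c := (1 : ℝ))).div (hac.add continuousOn_const) haδ)
    have hE : ContinuousOn E K := by fun_prop
    exact hE.mul (((((hRu.add hRv).const_mul _).sub
      ((((hρpow α).mul (huc.sub hvc)).mul hlog).div_const _)).sub
      ((hk.mul hatc).mul ((huc.add hvc).sub (hac.const_mul 2)))).sub
      ((hk.mul haxc).mul ((huc.sub hvc).div_const ε)))
  · exact ((hρpow _).add (hρpow _)).mul (((huc.sub hvc).div_const ε).pow 2)
  · intro p hp
    have h1 := differentiableAt_regRelEntropy (hud p hp) (had p hp) (huδ p (hsub hp))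
      (haδ p (hsub hp))
    have h2 := differentiableAt_regRelEntropy (hvd p hp) (had p hp) (hvδ p (hsub hp))
      (haδ p (hsub hp))
    fun_prop
  · intro p hp
    have h1 := differentiableAt_regRelEntropy (hud p hp) (had p hp) (huδ p (hsub hp))
      (haδ p (hsub hp))
    have h2 := differentiableAt_regRelEntropy (hvd p hp) (had p hp) (hvδ p (hsub hp))
      (haδ p (hsub hp))
    fun_prop
  · intro p hp
    obtain ⟨e1, e2⟩ := hpde p.1 hp.1 p.2 hp.2
    simp only [D, R, u', v']
    have e1' : deriv (fun s => u s p.2) p.1 + deriv (fun y => u p.1 y) p.2 / ε =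
        (u p.1 p.2 + v p.1 p.2) ^ α * (v p.1 p.2 - u p.1 p.2) / ε ^ 2 := by
      rw [← e1]; field_simp
    have e2' : deriv (fun s => v s p.2) p.1 - deriv (fun y => v p.1 y) p.2 / ε =
        (u p.1 p.2 + v p.1 p.2) ^ α * (u p.1 p.2 - v p.1 p.2) / ε ^ 2 := by
      rw [← e2]; field_simp
    linear_combination
      E p * (u p.1 p.2 ^ 2 - a p ^ 2 + log (u p.1 p.2 + δ) - log (a p + δ)) * e1' +
      E p * (v p.1 p.2 ^ 2 - a p ^ 2 + log (v p.1 p.2 + δ) - log (a p + δ)) * e2'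
  · intro p hp
    refine weighted_dissipation_le hα hp.1 hδ (hu0 p hp) (hv0 p hp) (hρδ p hp) hm (ham p hp) ?_ ?_
    · rw [abs_mul, abs_of_nonneg (hcoef p hp).1]
      exact (mul_le_mul (hcoef p hp).2 (hatB p hp) (abs_nonneg _)
        ((hcoef p hp).1.trans (hcoef p hp).2)).trans hM
    · rw [abs_mul, abs_of_nonneg (hcoef p hp).1]
      exact (mul_le_mul (hcoef p hp).2 (haxA p hp) (abs_nonneg _)
        ((hcoef p hp).1.trans (hcoef p hp).2)).trans hN
  · intro t ht
    have hmem : ((t, 0) : ℝ × ℝ) ∈ K := ⟨Ioo_subset_Icc_self ht, by simp⟩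
    have h1 : R u' (t, 0) = 0 := by
      simp only [R, u', a, (hbc t ht).1]
      simp [regRelEntropy_self]
    have h2 : 0 ≤ R v' (t, 0) := regRelEntropy_nonneg hδ (hv0 _ hmem) (hm.trans_le (ham _ hmem))
    refine mul_nonpos_of_nonneg_of_nonpos (hEpos _).le (div_nonpos_of_nonpos_of_nonneg ?_ hε.le)
    linarith
  · intro t ht
    have hmem : ((t, 1) : ℝ × ℝ) ∈ K := ⟨Ioo_subset_Icc_self ht, by simp⟩
    have h1 : R v' (t, 1) = 0 := by
      simp only [R, v', a, (hbc t ht).2]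
      simp [regRelEntropy_self]
    have h2 : 0 ≤ R u' (t, 1) := regRelEntropy_nonneg hδ (hu0 _ hmem) (hm.trans_le (ham _ hmem))
    refine mul_nonneg (hEpos _).le (div_nonneg ?_ hε.le)
    linarith
  · intro y hy
    have hmem : ((T, y) : ℝ × ℝ) ∈ K := ⟨right_mem_Icc.2 hT.le, hy⟩
    have ha := hm.trans_le (ham _ hmem)
    exact mul_nonneg (hEpos _).le (add_nonneg (regRelEntropy_nonneg hδ (hu0 _ hmem) ha)
      (regRelEntropy_nonneg hδ (hv0 _ hmem) ha))
  · intro y hy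
    have hmem : ((0, y) : ℝ × ℝ) ∈ K := ⟨left_mem_Icc.2 hT.le, hy⟩
    have h1 := regRelEntropy_le hδ (hu0 _ hmem) hm (ham _ hmem)
      ((hic y hy).1.trans_le (hin y hy).1) (haA _ hmem)
    have h2 := regRelEntropy_le hδ (hv0 _ hmem) hm (ham _ hmem)
      ((hic y hy).2.trans_le (hin y hy).2) (haA _ hmem)
    have hE0 : E (0, y) = 1 := by simp [E]
    simp only [f, hE0, R]
    linarith

end

/-- Entropy production estimates for `α ∈ [0,1]`: for admissible data there is a constant
`L`, independent of `ε`, such that `∫₀ᵀ∫₀¹ ρ_ε^{α+1} j_ε² ≤ L` and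
`∫₀ᵀ∫₀¹ ρ_ε^{α-1} j_ε² ≤ L` for every classical solution of the scaled generalized
Carleman system, where `ρ_ε = u_ε + v_ε` and `j_ε = (u_ε - v_ε)/ε`. -/
theorem entropy_production_uniform_bound_nonneg_alpha
    (α T : ℝ) (hα : α ∈ Set.Icc (0:ℝ) 1) (hT : 0 < T)
    (φm φp uin vin : ℝ → ℝ) (hdata : AdmissibleData T φm φp uin vin) :
    ∃ L : ℝ, 0 < L ∧ ∀ ε : ℝ, 0 < ε → ∀ u v : ℝ → ℝ → ℝ,
      IsScaledCarlemanSol α T ε φm φp uin vin u v →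
      (∫ t in (0:ℝ)..T, ∫ x in (0:ℝ)..1,
          (u t x + v t x) ^ (α + 1) * ((u t x - v t x) / ε) ^ 2) ≤ L ∧
      (∫ t in (0:ℝ)..T, ∫ x in (0:ℝ)..1,
          (u t x + v t x) ^ (α - 1) * ((u t x - v t x) / ε) ^ 2) ≤ L := by
  obtain ⟨hφmC, hφpC, hφpos, huinC, hvinC, -⟩ := id hdata
  have hne : (Icc 0 T).Nonempty := nonempty_Icc.2 hT.le
  have hlow : ∀ φ : ℝ → ℝ, ContDiffOn ℝ 1 φ (Icc 0 T) → (∀ t ∈ Icc 0 T, 0 < φ t) →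
      ∃ c, 0 < c ∧ ∀ t ∈ Icc 0 T, c ≤ φ t := fun φ hφ hpos => by
    obtain ⟨t₀, ht₀, hmin⟩ := isCompact_Icc.exists_isMinOn hne hφ.continuousOn
    exact ⟨φ t₀, hpos t₀ ht₀, fun t ht => hmin ht⟩
  have hup : ∀ (φ : ℝ → ℝ) (b : ℝ), ContinuousOn φ (Icc 0 b) →
      ∃ c, ∀ t ∈ Icc 0 b, |φ t| ≤ c := fun φ b hφ => by
    simpa using isCompact_Icc.exists_bound_of_continuousOn hφ
  obtain ⟨m₁, hm₁, hm₁'⟩ := hlow φm hφmC fun t ht => (hφpos t ht).1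
  obtain ⟨m₂, hm₂, hm₂'⟩ := hlow φp hφpC fun t ht => (hφpos t ht).2
  obtain ⟨A₁, hA₁⟩ := hup φm T hφmC.continuousOn
  obtain ⟨A₂, hA₂⟩ := hup φp T hφpC.continuousOn
  obtain ⟨B₁, hB₁⟩ := hup _ T (hφmC.continuousOn_derivWithin (uniqueDiffOn_Icc hT) le_rfl)
  obtain ⟨B₂, hB₂⟩ := hup _ T (hφpC.continuousOn_derivWithin (uniqueDiffOn_Icc hT) le_rfl)
  obtain ⟨U₁, hU₁⟩ := hup uin 1 huinC
  obtain ⟨U₂, hU₂⟩ := hup vin 1 hvinC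
  set m := min m₁ m₂
  set A := max A₁ A₂
  set B := max B₁ B₂
  set U := max U₁ U₂
  have hm : 0 < m := lt_min hm₁ hm₂
  set M := (2 * A + 1 / m) * B
  set N := (2 * A + 1 / m) * A
  set c := 1 / 4 * Real.exp (-(3 * M / (2 * m)) * T)
  have hc : 0 < c := by positivity
  set Q := (N ^ 2 + 2 * M) * T + 2 * ((U + A) ^ 2 * (U + 2 * A) / 3 + (U + A) ^ 2 / m)
  refine ⟨max (Q / c) 1, lt_max_of_lt_right one_pos, fun ε hε u v hsol => ?_⟩
  obtain ⟨huC, hvC, hpos, -⟩ := id hsol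
  have hu := huC.continuousOn
  have hv := hvC.continuousOn
  have hcomp : IsCompact (Icc 0 T ×ˢ Icc (0 : ℝ) 1) := isCompact_Icc.prod isCompact_Icc
  obtain ⟨p₀, hp₀, hmin⟩ := hcomp.exists_isMinOn (hne.prod (nonempty_Icc.2 zero_le_one))
    (hu.add hv)
  have hbound := hsol.mul_setIntegral_flux_le (A := A) (U := U) (M := M) (N := N)
    (δ := (u p₀.1 p₀.2 + v p₀.1 p₀.2) / 2) hα hT hε hm hdata
    (fun t ht => ⟨(min_le_left _ _).trans (hm₁' t ht),
      (le_abs_self _).trans ((hA₁ t ht).trans (le_max_left _ _)),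
      (hB₁ t ht).trans (le_max_left _ _)⟩)
    (fun t ht => ⟨(min_le_right _ _).trans (hm₂' t ht),
      (le_abs_self _).trans ((hA₂ t ht).trans (le_max_right _ _)),
      (hB₂ t ht).trans (le_max_right _ _)⟩)
    (fun x hx => ⟨(le_abs_self _).trans ((hU₁ x hx).trans (le_max_left _ _)),
      (le_abs_self _).trans ((hU₂ x hx).trans (le_max_right _ _))⟩)
    le_rfl le_rfl (half_pos (hpos p₀.1 hp₀.1 p₀.2 hp₀.2).2.2)
    (fun p hp => by
      have : u p₀.1 p₀.2 + v p₀.1 p₀.2 ≤ u p.1 p.2 + v p.1 p.2 := hmin hp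
      linarith)
  have hcont : ∀ r : ℝ, ContinuousOn (fun p : ℝ × ℝ =>
      (u p.1 p.2 + v p.1 p.2) ^ r * ((u p.1 p.2 - v p.1 p.2) / ε) ^ 2)
      (Icc 0 T ×ˢ Icc (0 : ℝ) 1) := fun r =>
    ((hu.add hv).rpow_const fun p hp => Or.inl (hpos p.1 hp.1 p.2 hp.2).2.2.ne').mul
      (((hu.sub hv).div_const ε).pow 2)
  have hnonneg : ∀ r : ℝ, 0 ≤ ∫ p in Icc 0 T ×ˢ Icc (0 : ℝ) 1,
      (u p.1 p.2 + v p.1 p.2) ^ r * ((u p.1 p.2 - v p.1 p.2) / ε) ^ 2 := fun r =>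
    setIntegral_nonneg (measurableSet_Icc.prod measurableSet_Icc) fun p hp =>
      mul_nonneg (Real.rpow_nonneg (hpos p.1 hp.1 p.2 hp.2).2.2.le r) (sq_nonneg _)
  simp_rw [add_mul (_ ^ (α + 1))] at hbound
  rw [integral_add ((hcont _).integrableOn_compact hcomp) ((hcont _).integrableOn_compact hcomp),
    mul_comm, ← le_div_iff₀ hc] at hbound
  have h1 := hnonneg (α + 1)
  have h2 := hnonneg (α - 1)
  rw [← intervalIntegral_eq_setIntegral_prod hT.le (hcont _)] at h1 h2
  rw [← intervalIntegral_eq_setIntegral_prod hT.le (hcont _),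
    ← intervalIntegral_eq_setIntegral_prod hT.le (hcont _)] at hbound
  dsimp only at h1 h2 hbound
  exact ⟨le_max_of_le_left (by linarith), le_max_of_le_left (by linarith)⟩
end

section
/- Let α ∈ [0,1). For all real numbers u, v ≥ 0 with u + v > 0, (u − v)(u + v)^α (u^{1−α} − v^{1−α}) ≥ (1 − α)(u − v)². -/
/-- The weighted AM-GM bound for the difference of powers, weakened by `x ^ α ≤ (x + y) ^ α`. -/
theorem one_sub_mul_sub_le_add_rpow_mul_rpow_sub {α x y : ℝ} (h₀ : 0 ≤ α) (h₁ : α ≤ 1)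
    (hy : 0 ≤ y) (hyx : y ≤ x) :
    (1 - α) * (x - y) ≤ (x + y) ^ α * (x ^ (1 - α) - y ^ (1 - α)) := by
  have hx : 0 ≤ x := hy.trans hyx
  have hβ : 0 ≤ 1 - α := sub_nonneg.2 h₁
  have hdiff : 0 ≤ x ^ (1 - α) - y ^ (1 - α) :=
    sub_nonneg.2 (Real.rpow_le_rpow hy hyx hβ)
  have hprod : x ^ α * x ^ (1 - α) = x := by
    rw [← Real.rpow_add_of_nonneg hx h₀ hβ, add_sub_cancel, Real.rpow_one]
  have hamgm : x ^ α * y ^ (1 - α) ≤ α * x + (1 - α) * y :=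
    Real.geom_mean_le_arith_mean2_weighted h₀ hβ hx hy (add_sub_cancel _ _)
  calc (1 - α) * (x - y) ≤ x ^ α * (x ^ (1 - α) - y ^ (1 - α)) := by
        rw [mul_sub (x ^ α), hprod]
        linarith
    _ ≤ (x + y) ^ α * (x ^ (1 - α) - y ^ (1 - α)) := by
        gcongr
        exact le_add_of_nonneg_right hy

/-- Pointwise lower bound on the entropy production integrand for the generalized Carleman
system with exponent `α ∈ [0,1)`: for `u, v ≥ 0` with `u + v > 0`,
`(u - v)(u + v)^α (u^{1-α} - v^{1-α}) ≥ (1-α)(u - v)²`. -/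
theorem entropy_production_pointwise_alpha_nonneg (α : ℝ) (hα : α ∈ Set.Ico (0:ℝ) 1)
    (u v : ℝ) (hu : 0 ≤ u) (hv : 0 ≤ v) (huv : 0 < u + v) :
    (u - v) * (u + v) ^ α * (u ^ (1 - α) - v ^ (1 - α)) ≥ (1 - α) * (u - v) ^ 2 := by
  rcases le_total v u with h | h
  · have key := one_sub_mul_sub_le_add_rpow_mul_rpow_sub hα.1 hα.2.le hv h
    linarith [mul_le_mul_of_nonneg_left key (sub_nonneg.2 h)]
  · have key := one_sub_mul_sub_le_add_rpow_mul_rpow_sub hα.1 hα.2.le hu h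
    rw [add_comm v u] at key
    linarith [mul_le_mul_of_nonneg_left key (sub_nonneg.2 h)]
end

section
/- Let α ∈ [-1,0). For all real numbers u, v > 0, (u − v)(u + v)^α (u^{1−α} − v^{1−α}) ≥ 2^α (u − v)². -/
/-- The entropy production bound on the region `v ≤ u`, for any nonpositive exponent. -/
theorem two_rpow_mul_sub_sq_le_of_le {α u v : ℝ} (hα : α ≤ 0) (hv : 0 < v) (hvu : v ≤ u) :
    (2 : ℝ) ^ α * (u - v) ^ 2 ≤ (u - v) * (u + v) ^ α * (u ^ (1 - α) - v ^ (1 - α)) := by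
  have hu : 0 < u := hv.trans_le hvu
  have hsub : 0 ≤ u - v := sub_nonneg.2 hvu
  have hsum : (2 : ℝ) ^ α * u ^ α ≤ (u + v) ^ α := by
    rw [← Real.mul_rpow zero_le_two hu.le]
    exact Real.rpow_le_rpow_of_nonpos (by positivity) (by linarith) hα
  have hdiff : u ^ (-α) * (u - v) ≤ u ^ (1 - α) - v ^ (1 - α) := by
    have hmono : v ^ (-α) ≤ u ^ (-α) := Real.rpow_le_rpow hv.le hvu (neg_nonneg.2 hα)
    have hsplit : ∀ y : ℝ, 0 < y → y ^ (1 - α) = y * y ^ (-α) := fun y hy ↦ by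
      rw [sub_eq_add_neg, Real.rpow_add hy, Real.rpow_one]
    rw [hsplit u hu, hsplit v hv]
    nlinarith [mul_le_mul_of_nonneg_left hmono hv.le]
  have hcancel : u ^ α * u ^ (-α) = 1 := by
    rw [← Real.rpow_add hu, add_neg_cancel, Real.rpow_zero]
  calc (2 : ℝ) ^ α * (u - v) ^ 2
      = (u - v) * ((2 : ℝ) ^ α * u ^ α) * (u ^ (-α) * (u - v)) := by
        linear_combination -((2 : ℝ) ^ α * (u - v) ^ 2) * hcancel
    _ ≤ (u - v) * (u + v) ^ α * (u ^ (1 - α) - v ^ (1 - α)) := by gcongr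

/-- Pointwise lower bound on the entropy production integrand for the generalized Carleman
system with exponent `α ∈ [-1,0)`: for `u, v > 0`,
`(u - v)(u + v)^α (u^{1-α} - v^{1-α}) ≥ 2^α (u - v)²`. -/
theorem entropy_production_pointwise_alpha_neg (α : ℝ) (hα : α ∈ Set.Ico (-1:ℝ) 0)
    (u v : ℝ) (hu : 0 < u) (hv : 0 < v) :
    (u - v) * (u + v) ^ α * (u ^ (1 - α) - v ^ (1 - α)) ≥ (2:ℝ) ^ α * (u - v) ^ 2 := by
  rcases le_total v u with h | h
  · exact two_rpow_mul_sub_sq_le_of_le hα.2.le hv h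
  · have key := two_rpow_mul_sub_sq_le_of_le hα.2.le hu h
    rw [add_comm v u] at key
    linarith
end

section
/- Let α ∈ (-1,0). For all real numbers u, v > 0, (u − v)(u + v)^α (u^{1+α} − v^{1+α}) ≥ (1 + α)(u + v)^{2α} (u − v)². -/
/-- The tangent line inequality for the concave power `x ↦ x ^ (1 + α)`, `α ∈ [-1, 0]`. -/
theorem mul_rpow_mul_sub_le_rpow_sub_rpow {α u v : ℝ} (hα : -1 ≤ α) (hα' : α ≤ 0)
    (hu : 0 < u) (hv : 0 ≤ v) :
    (1 + α) * u ^ α * (u - v) ≤ u ^ (1 + α) - v ^ (1 + α) := by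
  have hvu : 0 ≤ v / u := by positivity
  have h := rpow_one_add_le_one_add_mul_self (s := v / u - 1) (p := 1 + α)
    (by linarith) (by linarith) (by linarith)
  rw [add_sub_cancel, Real.div_rpow hv hu.le, div_le_iff₀ (by positivity)] at h
  have hpow : u ^ (1 + α) = u * u ^ α := by rw [Real.rpow_add hu, Real.rpow_one]
  have hexp : (1 + (1 + α) * (v / u - 1)) * (u * u ^ α)
      = u * u ^ α + (1 + α) * u ^ α * (v - u) := by
    field_simp
  rw [hpow] at h ⊢
  linarith

/-- The entropy production bound for ordered arguments. -/
theorem entropy_production_pointwise_of_le {α u v : ℝ} (hα : -1 ≤ α) (hα' : α ≤ 0)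
    (hv : 0 < v) (hvu : v ≤ u) :
    (1 + α) * (u + v) ^ (2 * α) * (u - v) ^ 2
      ≤ (u - v) * (u + v) ^ α * (u ^ (1 + α) - v ^ (1 + α)) := by
  have hu : 0 < u := hv.trans_le hvu
  have hsub : 0 ≤ u - v := sub_nonneg.2 hvu
  have h1 : 0 ≤ 1 + α := by linarith
  have hmono : (u + v) ^ α ≤ u ^ α := Real.rpow_le_rpow_of_nonpos hu (by linarith) hα'
  calc (1 + α) * (u + v) ^ (2 * α) * (u - v) ^ 2
      = (u - v) * (u + v) ^ α * ((1 + α) * (u + v) ^ α * (u - v)) := by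
        rw [two_mul, Real.rpow_add (by positivity)]
        ring
    _ ≤ (u - v) * (u + v) ^ α * ((1 + α) * u ^ α * (u - v)) := by gcongr
    _ ≤ _ := by
        gcongr
        exact mul_rpow_mul_sub_le_rpow_sub_rpow hα hα' hu hv.le

/-- Pointwise lower bound on the entropy production integrand for the generalized Carleman
system with exponent `α ∈ (-1,0)`: for `u, v > 0`,
`(u - v)(u + v)^α (u^{1+α} - v^{1+α}) ≥ (1+α)(u+v)^{2α} (u-v)²`. -/
theorem entropy_production_pointwise_abs_alpha (α : ℝ) (hα : α ∈ Set.Ioo (-1:ℝ) 0)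
    (u v : ℝ) (hu : 0 < u) (hv : 0 < v) :
    (u - v) * (u + v) ^ α * (u ^ (1 + α) - v ^ (1 + α))
      ≥ (1 + α) * (u + v) ^ (2 * α) * (u - v) ^ 2 := by
  rcases le_total v u with h | h
  · exact entropy_production_pointwise_of_le hα.1.le hα.2.le hv h
  · have := entropy_production_pointwise_of_le hα.1.le hα.2.le hu h
    rw [add_comm v u] at this
    linarith
end
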